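/- Suppose R is a principal ideal domain. Let S₁ be a set of representatives, up to multiplication by units of R, of the pairs (c,d) ∈ R² satisfying: c ≠ 0, cR + dR = R, |N(c)| ≤ 2k/k₀², |d/c| < ε₀·√(2k/(N(c)²k₀²) − k₀²/(2k)) + (1+ω)/2, and |d'/c'| < ε₀·√(2k/(N(c)²k₀²) − k₀²/(2k)) + (1−ω')/2. For each (c,d) ∈ S₁ choose a,b ∈ R with ad − bc = 1 and set P_{c,d} = (a b; c d) ∈ Γ. Then Γ is generated by P₁ = (1 1; 0 1), P₂ = (1 ω; 0 1), P₃ = (ε₀ 0; 0 ε₀⁻¹) together with the elements P_{c,d} for (c,d) ∈ S₁. -/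

import Mathlib

noncomputable section

open scoped Classical
open MeasureTheory

namespace Hilbert

/-- `k₀ = 2` if `k ≡ 1 (mod 4)` and `k₀ = 1` otherwise. -/
def k0 (k : ℕ) : ℝ := if k % 4 = 1 then 2 else 1

/-- `ω = (1 + √k)/k₀`. -/
def omg (k : ℕ) : ℝ := (1 + Real.sqrt k) / k0 k

/-- `ω' = (1 - √k)/k₀`, the algebraic conjugate of `ω`. -/
def omg' (k : ℕ) : ℝ := (1 - Real.sqrt k) / k0 k

/-- The ring `R = ℤ[ω]`, realized inside `ℝ × ℝ` via the pair of real embeddings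
`α ↦ (α, α')` of `K = ℚ(√k)`. -/
def R (k : ℕ) : Subring (ℝ × ℝ) := Subring.closure {(omg k, omg' k)}

/-- The ambient space `ℝ⁴`, with coordinates `(x₁, x₂, y₁, y₂)`. -/
abbrev Pt : Type := ℝ × ℝ × ℝ × ℝ

def x1 (p : Pt) : ℝ := p.1
def x2 (p : Pt) : ℝ := p.2.1
def y1 (p : Pt) : ℝ := p.2.2.1
def y2 (p : Pt) : ℝ := p.2.2.2

/-- `H² × H²`, identified with an open subset of `ℝ⁴`. -/
def HH : Set Pt := {p | 0 < y1 p ∧ 0 < y2 p}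

/-- The coordinate `s₁`, determined by `x₁ = s₁ + s₂ ω`, `x₂ = s₁ + s₂ ω'`. -/
def s1 (k : ℕ) (p : Pt) : ℝ := (omg' k * x1 p - omg k * x2 p) / (omg' k - omg k)

/-- The coordinate `s₂`. -/
def s2 (k : ℕ) (p : Pt) : ℝ := (x1 p - x2 p) / (omg k - omg' k)

/-- The ratio `r = y₁/y₂`. -/
def rr (p : Pt) : ℝ := y1 p / y2 p

/-- The height `h = y₁ y₂`. -/
def hh (p : Pt) : ℝ := y1 p * y2 p

/-- `‖cZ+d‖ = ((cx₁+d)² + c²y₁²)((c'x₂+d')² + c'²y₂²)`, where `c = (c, c')`, `d = (d, d')`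
are given by their two real embeddings. -/
def HNorm (c d : ℝ × ℝ) (p : Pt) : ℝ :=
  ((c.1 * x1 p + d.1) ^ 2 + c.1 ^ 2 * y1 p ^ 2) *
    ((c.2 * x2 p + d.2) ^ 2 + c.2 ^ 2 * y2 p ^ 2)

/-- `S = {(c,d) ∈ R² : cR + dR = R}`. -/
def Spairs (k : ℕ) : Set (R k × R k) := {cd | Ideal.span {cd.1, cd.2} = ⊤}

/-- `V_{c,d}^≥ = {Z ∈ H²×H² : ‖cZ+d‖ ≥ 1}`. -/
def Vge (k : ℕ) (cd : R k × R k) : Set Pt :=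
  {p ∈ HH | 1 ≤ HNorm (cd.1 : ℝ × ℝ) (cd.2 : ℝ × ℝ) p}

/-- `V_{c,d}^≤ = {Z ∈ H²×H² : ‖cZ+d‖ ≤ 1}`. -/
def Vle (k : ℕ) (cd : R k × R k) : Set Pt :=
  {p ∈ HH | HNorm (cd.1 : ℝ × ℝ) (cd.2 : ℝ × ℝ) p ≤ 1}

/-- `V_{c,d} = {Z ∈ H²×H² : ‖cZ+d‖ = 1}`. -/
def Veq (k : ℕ) (cd : R k × R k) : Set Pt :=
  {p ∈ HH | HNorm (cd.1 : ℝ × ℝ) (cd.2 : ℝ × ℝ) p = 1}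

/-- `F₀ = {Z ∈ H²×H² : ‖cZ+d‖ ≥ 1 for all (c,d) ∈ S}`. -/
def F0 (k : ℕ) : Set Pt :=
  {p ∈ HH | ∀ cd ∈ Spairs k, 1 ≤ HNorm (cd.1 : ℝ × ℝ) (cd.2 : ℝ × ℝ) p}

/-- `F_∞ = {(s₁,s₂,r,h) : |s₁| ≤ 1/2, |s₂| ≤ 1/2, ε₀⁻² ≤ r ≤ ε₀²}`, where `ε` stands
for the fundamental unit `ε₀`. -/
def FInf (k : ℕ) (ε : ℝ) : Set Pt :=
  {p ∈ HH | |s1 k p| ≤ 1 / 2 ∧ |s2 k p| ≤ 1 / 2 ∧ (ε ^ 2)⁻¹ ≤ rr p ∧ rr p ≤ ε ^ 2}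

/-- `F = F_∞ ∩ F₀`. -/
def F (k : ℕ) (ε : ℝ) : Set Pt := FInf k ε ∩ F0 k

/-- `SL₂(R)`. -/
abbrev SL (k : ℕ) := Matrix.SpecialLinearGroup (Fin 2) (R k)

/-- Möbius action on the upper half-plane: image of `x + y i` under `(a b; c d)`. -/
def moeb (a b c d x y : ℝ) : ℝ × ℝ :=
  (((a * x + b) * (c * x + d) + a * c * y ^ 2) / ((c * x + d) ^ 2 + c ^ 2 * y ^ 2),
    y / ((c * x + d) ^ 2 + c ^ 2 * y ^ 2))

/-- The action of `γ ∈ SL₂(R)` on `H²×H²`: `γ` acts on the first factor through the first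
embedding and through the conjugate matrix `γ'` (second embedding) on the second factor.
This descends to the Hilbert modular group `PSL₂(R)`. -/
def act (k : ℕ) (g : SL k) (p : Pt) : Pt :=
  ((moeb (g.1 0 0 : ℝ × ℝ).1 (g.1 0 1 : ℝ × ℝ).1 (g.1 1 0 : ℝ × ℝ).1 (g.1 1 1 : ℝ × ℝ).1
      (x1 p) (y1 p)).1,
   (moeb (g.1 0 0 : ℝ × ℝ).2 (g.1 0 1 : ℝ × ℝ).2 (g.1 1 0 : ℝ × ℝ).2 (g.1 1 1 : ℝ × ℝ).2
      (x2 p) (y2 p)).1,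
   (moeb (g.1 0 0 : ℝ × ℝ).1 (g.1 0 1 : ℝ × ℝ).1 (g.1 1 0 : ℝ × ℝ).1 (g.1 1 1 : ℝ × ℝ).1
      (x1 p) (y1 p)).2,
   (moeb (g.1 0 0 : ℝ × ℝ).2 (g.1 0 1 : ℝ × ℝ).2 (g.1 1 0 : ℝ × ℝ).2 (g.1 1 1 : ℝ × ℝ).2
      (x2 p) (y2 p)).2)

/-- The pair of real embeddings of a unit of `R`. -/
def unitVal (k : ℕ) (u : (R k)ˣ) : ℝ × ℝ := ((u : R k) : ℝ × ℝ)

/-- `e` is the fundamental unit of `R`: the smallest unit of `R` greater than `1`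
(with respect to the first embedding). -/
def IsFundUnit (k : ℕ) (e : (R k)ˣ) : Prop :=
  1 < (unitVal k e).1 ∧
    ∀ v : (R k)ˣ, 1 < (unitVal k v).1 → (unitVal k e).1 ≤ (unitVal k v).1

/-- The real number `ε₀ > 1`, the fundamental unit under the first embedding. -/
def eps (k : ℕ) (e : (R k)ˣ) : ℝ := (unitVal k e).1


/-- The norm `N(c) = c c'` of an element of `R` (as a real number). -/
def Nm (k : ℕ) (c : R k) : ℝ := ((c : ℝ × ℝ)).1 * ((c : ℝ × ℝ)).2

/-- A subset `C` of `H²×H²` is hyperbolically bounded if it is bounded in the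
Euclidean metric and `y₁, y₂ > ε` on `C` for some `ε > 0`. -/
def HypBounded (C : Set Pt) : Prop :=
  C ⊆ HH ∧ Bornology.IsBounded C ∧ ∃ ε > (0 : ℝ), ∀ p ∈ C, ε < y1 p ∧ ε < y2 p

/-- `V_{C,μ} = {(c,d) ∈ R × R : ‖cZ+d‖ ≤ μ for some Z ∈ C}`. -/
def VCmu (k : ℕ) (C : Set Pt) (μ : ℝ) : Set (R k × R k) :=
  {cd | ∃ p ∈ C, HNorm (cd.1 : ℝ × ℝ) (cd.2 : ℝ × ℝ) p ≤ μ}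

/-- The conditions (8) of Theorem `FiniteSides` on a pair `(c,d) ∈ R²`. -/
def SCond (k : ℕ) (ε : ℝ) (cd : R k × R k) : Prop :=
  cd.1 ≠ 0 ∧ Ideal.span {cd.1, cd.2} = ⊤ ∧
    |Nm k cd.1| ≤ 2 * k / (k0 k) ^ 2 ∧
    |((cd.2 : ℝ × ℝ)).1 / ((cd.1 : ℝ × ℝ)).1| <
      ε * Real.sqrt (2 * k / (Nm k cd.1 ^ 2 * (k0 k) ^ 2) - (k0 k) ^ 2 / (2 * k)) +
        (1 + omg k) / 2 ∧
    |((cd.2 : ℝ × ℝ)).2 / ((cd.1 : ℝ × ℝ)).2| <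
      ε * Real.sqrt (2 * k / (Nm k cd.1 ^ 2 * (k0 k) ^ 2) - (k0 k) ^ 2 / (2 * k)) +
        (1 - omg' k) / 2

/-- `S₁` is a set of representatives, up to multiplication by units of `R`, of the pairs
`(c,d) ∈ R²` satisfying the conditions `SCond`. -/
def IsRepSet (k : ℕ) (ε : ℝ) (S1 : Set (R k × R k)) : Prop :=
  (∀ cd ∈ S1, SCond k ε cd) ∧
    (∀ cd : R k × R k, SCond k ε cd →
      ∃ ab ∈ S1, ∃ u : (R k)ˣ, cd.1 = (u : R k) * ab.1 ∧ cd.2 = (u : R k) * ab.2) ∧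
    (∀ ab ∈ S1, ∀ ab' ∈ S1,
      (∃ u : (R k)ˣ, ab'.1 = (u : R k) * ab.1 ∧ ab'.2 = (u : R k) * ab.2) → ab = ab')

/-- The family `𝒱_∞ = {V_i^± : i = 1,2,3}`. -/
def VfamInf (k : ℕ) (ε : ℝ) : Set (Set Pt) :=
  { {p ∈ HH | s1 k p = 1 / 2}, {p ∈ HH | s1 k p = -(1 / 2)},
    {p ∈ HH | s2 k p = 1 / 2}, {p ∈ HH | s2 k p = -(1 / 2)},
    {p ∈ HH | rr p = ε ^ 2}, {p ∈ HH | rr p = (ε ^ 2)⁻¹} }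

/-- The family `𝒱 = {V_{c,d} : (c,d) ∈ S, c ≠ 0}`. -/
def Vfam (k : ℕ) : Set (Set Pt) :=
  {V | ∃ cd ∈ Spairs k, cd.1 ≠ 0 ∧ V = Veq k cd}

/-- The family `𝓜 = {γ(M) : γ ∈ Γ, M ∈ 𝒱 ∪ 𝒱_∞}`. -/
def Mfam (k : ℕ) (ε : ℝ) : Set (Set Pt) :=
  {M | ∃ g : SL k, ∃ V ∈ Vfam k ∪ VfamInf k ε, M = act k g '' V}

/-- `ω` as an element of `R`. -/
def omR (k : ℕ) : R k := ⟨(omg k, omg' k), Subring.subset_closure rfl⟩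

/-- The side-pairing transformations: `γ ≠ 1` (in `PSL₂(R)`) such that `F ∩ γ⁻¹(F)` has
Hausdorff dimension `3`. -/
def SidePairings (k : ℕ) (ε : ℝ) : Set (SL k) :=
  {g | g ≠ 1 ∧ g.1 ≠ -1 ∧ dimH (F k ε ∩ act k g⁻¹ '' F k ε) = 3}


lemma k0_cases (k : ℕ) : (k0 k = 2 ∧ k % 4 = 1) ∨ (k0 k = 1 ∧ k % 4 ≠ 1) := by
  unfold k0; split_ifs with h
  · left; exact ⟨rfl, h⟩
  · right; exact ⟨rfl, h⟩

lemma k0_pos (k : ℕ) : 0 < k0 k := by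
  rcases k0_cases k with h | h <;> rw [h.1] <;> norm_num

lemma irr (k : ℕ) (hk : Squarefree k) (hk1 : 1 < k) : Irrational (Real.sqrt k) := by
  rw [irrational_sqrt_natCast_iff]
  rintro ⟨r, hr⟩
  have h1 := hk r ⟨1, by rw [hr]; ring⟩
  rw [Nat.isUnit_iff] at h1
  subst h1
  omega

lemma one_lt_sqrt (k : ℕ) (hk1 : 1 < k) : 1 < Real.sqrt k := by
  rw [Real.lt_sqrt (by norm_num)]; norm_num; exact_mod_cast hk1

lemma om_pos (k : ℕ) : 0 < omg k := by
  unfold omg; have := k0_pos k; positivity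

lemma om'_neg (k : ℕ) (hk1 : 1 < k) : omg' k < 0 := by
  unfold omg'
  have := k0_pos k; have := one_lt_sqrt k hk1
  apply div_neg_of_neg_of_pos <;> linarith

lemma om_sub_pos (k : ℕ) (hk1 : 1 < k) : 0 < omg k - omg' k := by
  have := om_pos k; have := om'_neg k hk1; linarith

lemma om_sub_sq (k : ℕ) : (omg k - omg' k) ^ 2 = 4 * k / (k0 k) ^ 2 := by
  unfold omg omg'
  have := k0_pos k
  have h : Real.sqrt k ^ 2 = k := Real.sq_sqrt (by positivity)
  field_simp
  ring_nf; rw [h]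

lemma om_int (k : ℕ) : ∃ τ ν : ℤ, omg k + omg' k = τ ∧ omg k * omg' k = ν := by
  have h : Real.sqrt k * Real.sqrt k = k := Real.mul_self_sqrt (by positivity)
  unfold omg omg'
  rcases k0_cases k with ⟨h0, h1⟩ | ⟨h0, h1⟩ <;> rw [h0]
  · obtain ⟨j, hj⟩ : ∃ j, k = 4 * j + 1 := ⟨k / 4, by omega⟩
    refine ⟨1, -j, by push_cast; ring, ?_⟩
    have : (k : ℝ) = 4 * j + 1 := by exact_mod_cast hj
    push_cast
    linear_combination (-1/4) * h - (1/4) * this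
  · exact ⟨2, 1 - k, by push_cast; ring, by push_cast; linear_combination - h⟩

lemma om_indep (k : ℕ) (hk : Squarefree k) (hk1 : 1 < k) (a b : ℤ)
    (h : (a : ℝ) + b * omg k = 0 ∨ (a : ℝ) + b * omg' k = 0) : a = 0 ∧ b = 0 := by
  have hi := irr k hk hk1
  obtain ⟨m, hm⟩ : ∃ m : ℤ, k0 k = m := by
    rcases k0_cases k with h | h
    · exact ⟨2, by rw [h.1]; norm_num⟩
    · exact ⟨1, by rw [h.1]; norm_num⟩
  have hm0 := k0_pos k
  have hb : b = 0 := by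
    by_contra hb
    have hb' : (b : ℝ) ≠ 0 := by exact_mod_cast hb
    unfold omg omg' at h
    apply hi
    rcases h with h | h
    · refine ⟨(-a * m - b) / b, ?_⟩
      push_cast
      rw [← hm]
      field_simp at h ⊢
      linarith
    · refine ⟨(a * m + b) / b, ?_⟩
      push_cast
      rw [← hm]
      field_simp at h ⊢
      linarith
  subst hb
  simpa using h

lemma R_mk (k : ℕ) (a b : ℤ) :
    ∃ x : R k, x.1.1 = a + b * omg k ∧ x.1.2 = a + b * omg' k := by
  refine ⟨(a : R k) + (b : R k) * omR k, ?_, ?_⟩ <;> simp [omR]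

lemma R_mk' (k : ℕ) (a b : ℤ) (x : R k) (h1 : x.1.1 = a + b * omg k)
    (h2 : x.1.2 = a + b * omg' k) : x = (a : R k) + (b : R k) * omR k := by
  apply Subtype.ext; apply Prod.ext
  · simp [omR, h1]
  · simp [omR, h2]

lemma R_rep (k : ℕ) (x : R k) :
    ∃ a b : ℤ, x.1.1 = a + b * omg k ∧ x.1.2 = a + b * omg' k := by
  obtain ⟨τ, ν, hτ, hν⟩ := om_int k
  obtain ⟨x, hx⟩ := x
  unfold R at hx
  induction hx using Subring.closure_induction with
  | mem x hx => rw [Set.mem_singleton_iff] at hx; subst hx; exact ⟨0, 1, by simp, by simp⟩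
  | zero => exact ⟨0, 0, by simp, by simp⟩
  | one => exact ⟨1, 0, by simp, by simp⟩
  | add x y _ _ i1 i2 =>
    obtain ⟨a, b, h1, h2⟩ := i1
    obtain ⟨a', b', h3, h4⟩ := i2
    refine ⟨a + a', b + b', ?_, ?_⟩
    · simp at *; rw [h1, h3]; ring
    · simp at *; rw [h2, h4]; ring
  | neg x _ h1 =>
    obtain ⟨a, b, h1, h2⟩ := h1
    refine ⟨-a, -b, ?_, ?_⟩
    · simp at *; rw [h1]; ring
    · simp at *; rw [h2]; ring
  | mul x y _ _ i1 i2 =>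
    obtain ⟨a, b, h1, h2⟩ := i1
    obtain ⟨a', b', h3, h4⟩ := i2
    have e1 : omg k * omg k = τ * omg k - ν := by linear_combination omg k * hτ - hν
    have e2 : omg' k * omg' k = τ * omg' k - ν := by linear_combination omg' k * hτ - hν
    refine ⟨a * a' - b * b' * ν, a * b' + a' * b + b * b' * τ, ?_, ?_⟩
    · simp at *; rw [h1, h3]; linear_combination b * b' * e1
    · simp at *; rw [h2, h4]; linear_combination b * b' * e2

lemma R_conj (k : ℕ) (x : R k) : ∃ y : R k, y.1.1 = x.1.2 ∧ y.1.2 = x.1.1 := by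
  obtain ⟨a, b, h1, h2⟩ := R_rep k x
  obtain ⟨τ, ν, hτ, hν⟩ := om_int k
  obtain ⟨y, h3, h4⟩ := R_mk k (a + b * τ) (-b)
  refine ⟨y, ?_, ?_⟩
  · rw [h3, h2]; push_cast; linear_combination - b * hτ
  · rw [h4, h1]; push_cast; linear_combination - b * hτ

lemma R_ne (k : ℕ) (hk : Squarefree k) (hk1 : 1 < k) (x : R k) (hx : x ≠ 0) :
    x.1.1 ≠ 0 ∧ x.1.2 ≠ 0 := by
  obtain ⟨a, b, h1, h2⟩ := R_rep k x
  constructor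
  · intro h
    obtain ⟨rfl, rfl⟩ := om_indep k hk hk1 a b (Or.inl (h1 ▸ h))
    apply hx; apply Subtype.ext; apply Prod.ext <;> simp [h1, h2]
  · intro h
    obtain ⟨rfl, rfl⟩ := om_indep k hk hk1 a b (Or.inr (h2 ▸ h))
    apply hx; apply Subtype.ext; apply Prod.ext <;> simp [h1, h2]

lemma R_ext1 (k : ℕ) (hk : Squarefree k) (hk1 : 1 < k) (x y : R k) (h : x.1.1 = y.1.1) :
    x = y := by
  by_contra hxy
  apply (R_ne k hk hk1 (x - y) (sub_ne_zero.2 hxy)).1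
  simp [h]

lemma R_cancel (k : ℕ) (hk : Squarefree k) (hk1 : 1 < k) (g x y : R k) (hg : g ≠ 0)
    (h : g * x = g * y) : x = y := by
  apply R_ext1 k hk hk1
  have := congrArg (fun z : R k => z.1.1) h
  simp at this
  rcases this with h | h
  · exact h
  · exact absurd h (R_ne k hk hk1 g hg).1

lemma Nm_int (k : ℕ) (x : R k) : ∃ n : ℤ, Nm k x = n := by
  obtain ⟨a, b, h1, h2⟩ := R_rep k x
  obtain ⟨τ, ν, hτ, hν⟩ := om_int k
  refine ⟨a * a + a * b * τ + b * b * ν, ?_⟩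
  unfold Nm
  rw [h1, h2]; push_cast
  linear_combination a * b * hτ + b * b * hν

lemma Nm_mul (k : ℕ) (x y : R k) : Nm k (x * y) = Nm k x * Nm k y := by
  unfold Nm; simp; ring

lemma Nm_sq (k : ℕ) (hk : Squarefree k) (hk1 : 1 < k) (x : R k) (hx : x ≠ 0) :
    1 ≤ Nm k x ^ 2 := by
  obtain ⟨n, hn⟩ := Nm_int k x
  have h := R_ne k hk hk1 x hx
  have h0 : Nm k x ≠ 0 := mul_ne_zero h.1 h.2
  rw [hn] at h0 ⊢
  have h1 : n ≠ 0 := by exact_mod_cast h0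
  have : 1 ≤ n ^ 2 := by have := sq_pos_of_ne_zero h1; omega
  exact_mod_cast this

lemma unit_ne (k : ℕ) (u : (R k)ˣ) : (u : R k) ≠ 0 := by
  intro h
  have h1 := u.mul_inv
  rw [h, zero_mul] at h1
  have := congrArg (fun z : R k => z.1.1) h1
  simp at this

lemma Nm_unit (k : ℕ) (hk : Squarefree k) (hk1 : 1 < k) (u : (R k)ˣ) :
    Nm k u ^ 2 = 1 := by
  have h1 := Nm_sq k hk hk1 u (unit_ne k u)
  have h2 := Nm_sq k hk hk1 (u⁻¹ : (R k)ˣ) (unit_ne k _)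
  have h3 : Nm k u * Nm k (u⁻¹ : (R k)ˣ) = 1 := by
    rw [← Nm_mul, u.mul_inv]; simp [Nm]
  have h4 : Nm k u ^ 2 * Nm k (u⁻¹ : (R k)ˣ) ^ 2 = 1 := by rw [← mul_pow, h3, one_pow]
  nlinarith

/-- finiteness of bounded sets -/
lemma R_fin (k : ℕ) (hk1 : 1 < k) (M : ℝ) :
    {x : R k | |x.1.1| ≤ M ∧ |x.1.2| ≤ M}.Finite := by
  have hD := om_sub_pos k hk1
  set B := 2 * M / (omg k - omg' k) with hB
  set A := M + B * omg k with hA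
  have hf : ((Set.Icc (-⌈A⌉) ⌈A⌉) ×ˢ (Set.Icc (-⌈B⌉) ⌈B⌉) : Set (ℤ × ℤ)).Finite :=
    (Set.finite_Icc _ _).prod (Set.finite_Icc _ _)
  refine (hf.image (fun p => ((p.1 : R k) + (p.2 : R k) * omR k))).subset ?_
  rintro x ⟨hx1, hx2⟩
  obtain ⟨a, b, h1, h2⟩ := R_rep k x
  refine ⟨(a, b), ?_, (R_mk' k a b x h1 h2).symm⟩
  have hb : |(b : ℝ)| ≤ B := by
    rw [hB, le_div_iff₀ hD, ← abs_of_pos hD, ← abs_mul]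
    have : (b : ℝ) * (omg k - omg' k) = x.1.1 - x.1.2 := by rw [h1, h2]; ring
    rw [this]
    have := abs_sub x.1.1 x.1.2
    linarith
  have ha : |(a : ℝ)| ≤ A := by
    have : (a : ℝ) = x.1.1 - b * omg k := by rw [h1]; ring
    rw [this, hA]
    have h3 := abs_sub x.1.1 (b * omg k)
    rw [abs_mul, abs_of_pos (om_pos k)] at h3
    have := mul_le_mul_of_nonneg_right hb (om_pos k).le
    linarith
  have key : ∀ (n : ℤ) (C : ℝ), |(n : ℝ)| ≤ C → n ∈ Set.Icc (-⌈C⌉) ⌈C⌉ := by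
    intro n C h
    have h1 := abs_le.1 (h.trans (Int.le_ceil C))
    exact ⟨by exact_mod_cast h1.1, by exact_mod_cast h1.2⟩
  exact ⟨key _ _ ha, key _ _ hb⟩

lemma core_ineq (p q r X Y Z : ℝ) (hp : 0 ≤ p) (hq : 0 ≤ q) (hr : 0 ≤ r)
    (hX : 0 ≤ X) (hY : 0 ≤ Y) (hZ : 0 ≤ Z)
    (h1 : X ≤ p + q) (h2 : Y ≤ p + r) (h3 : Z ≤ q + r)
    (t1 : X ≤ Y + Z) (t2 : Y ≤ X + Z) (t3 : Z ≤ X + Y) :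
    4 * X * Y - (X + Y - Z) ^ 2 ≤ 4 * (p * q + q * r + r * p) := by
  set p0 := (X + Y - Z) / 2 with hp0
  set q0 := (X + Z - Y) / 2 with hq0
  set r0 := (Y + Z - X) / 2 with hr0
  have e1 : X = p0 + q0 := by rw [hp0, hq0]; ring
  have e2 : Y = p0 + r0 := by rw [hp0, hr0]; ring
  have e3 : Z = q0 + r0 := by rw [hr0, hq0]; ring
  have P0 : 0 ≤ p0 := by rw [hp0]; linarith
  have Q0 : 0 ≤ q0 := by rw [hq0]; linarith
  have R0 : 0 ≤ r0 := by rw [hr0]; linarith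
  clear_value p0 q0 r0
  subst e1 e2 e3
  have key : p0 * q0 + q0 * r0 + r0 * p0 ≤ p * q + q * r + r * p := by
    by_cases c1 : p ≤ p0
    · have := mul_le_mul h1 h2 hY (by linarith)
      have := mul_self_le_mul_self hp c1
      nlinarith
    by_cases c2 : q ≤ q0
    · have := mul_le_mul h1 h3 hZ (by linarith)
      have := mul_self_le_mul_self hq c2
      nlinarith
    by_cases c3 : r ≤ r0
    · have := mul_le_mul h2 h3 hZ (by linarith)
      have := mul_self_le_mul_self hr c3
      nlinarith
    push Not at c1 c2 c3
    have := mul_le_mul c1.le c2.le Q0 hp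
    have := mul_le_mul c2.le c3.le R0 hq
    have := mul_le_mul c3.le c1.le P0 hr
    linarith
  nlinarith

lemma core_ineq2 (a p q r α β γ : ℝ) (ha : 0 < a) (hp : 0 ≤ p) (hq : 0 ≤ q) (hr : 0 ≤ r)
    (hα : α ^ 2 ≤ 1 / 4) (hβ : β ^ 2 ≤ 1 / 4) (hγ : γ ^ 2 ≤ 1 / 4)
    (h1 : a ≤ a * α ^ 2 + (p + q)) (h2 : a ≤ a * β ^ 2 + (p + r))
    (h3 : a ≤ a * γ ^ 2 + (q + r))
    (hm : 2 ≤ 4 * (1 - α ^ 2) * (1 - β ^ 2) - (1 - α ^ 2 - β ^ 2 + γ ^ 2) ^ 2) :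
    a ^ 2 ≤ 2 * (p * q + q * r + r * p) := by
  have := core_ineq p q r (a * (1 - α ^ 2)) (a * (1 - β ^ 2)) (a * (1 - γ ^ 2)) hp hq hr
    (by apply mul_nonneg ha.le; linarith) (by apply mul_nonneg ha.le; linarith)
    (by apply mul_nonneg ha.le; linarith)
    (by linarith) (by linarith) (by linarith)
    (by rw [← mul_add]; apply mul_le_mul_of_nonneg_left _ ha.le; nlinarith [sq_nonneg α])
    (by rw [← mul_add]; apply mul_le_mul_of_nonneg_left _ ha.le; nlinarith [sq_nonneg β])
    (by rw [← mul_add]; apply mul_le_mul_of_nonneg_left _ ha.le; nlinarith [sq_nonneg γ])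
  have h5 := mul_le_mul_of_nonneg_left hm (sq_nonneg a)
  nlinarith

lemma core_ineq3 (a p q r α β : ℝ) (ha : 0 < a) (hp : 0 ≤ p) (hq : 0 ≤ q) (hr : 0 ≤ r)
    (hα : |α| ≤ 1 / 2) (hβ : |β| ≤ 1 / 2)
    (h1 : a ≤ a * α ^ 2 + (p + q)) (h2 : a ≤ a * β ^ 2 + (p + r))
    (h3 : ∀ e : ℤ, a ≤ a * (α - β + e) ^ 2 + (q + r)) :
    a ^ 2 ≤ 2 * (p * q + q * r + r * p) := by
  rw [abs_le] at hα hβ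
  have hα2 : α ^ 2 ≤ 1 / 4 := by nlinarith
  have hβ2 : β ^ 2 ≤ 1 / 4 := by nlinarith
  rcases le_total (α - β) (-1/2) with c | c
  · have h := h3 1
    push_cast at h
    refine core_ineq2 a p q r α β (α - β + 1) ha hp hq hr hα2 hβ2 (by nlinarith) h1 h2 h ?_
    have : 4 * (1 - α ^ 2) * (1 - β ^ 2) - (1 - α ^ 2 - β ^ 2 + (α - β + 1) ^ 2) ^ 2
      = 8 * (1 + α) * (1 - β) * (β - α) := by ring
    rw [this]
    nlinarith [mul_nonneg (mul_nonneg (show 0 ≤ 1 + 2 * α by linarith) (show 0 ≤ 1 - 2 * β by linarith)) (show 0 ≤ -1 - 2 * (α - β) by linarith), mul_nonneg (mul_nonneg (show 0 ≤ -α by linarith) (show 0 ≤ β by linarith)) (show 0 ≤ α - β + 1 by linarith)]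
  rcases le_total (1/2) (α - β) with c' | c'
  · have h := h3 (-1)
    push_cast at h
    refine core_ineq2 a p q r α β (α - β + -1) ha hp hq hr hα2 hβ2 (by nlinarith) h1 h2 h ?_
    have : 4 * (1 - α ^ 2) * (1 - β ^ 2) - (1 - α ^ 2 - β ^ 2 + (α - β + -1) ^ 2) ^ 2
      = 8 * (1 - α) * (1 + β) * (α - β) := by ring
    rw [this]
    nlinarith [mul_nonneg (mul_nonneg (show 0 ≤ 1 - 2 * α by linarith) (show 0 ≤ 1 + 2 * β by linarith)) (show 0 ≤ -1 + 2 * (α - β) by linarith), mul_nonneg (mul_nonneg (show 0 ≤ α by linarith) (show 0 ≤ -β by linarith)) (show 0 ≤ β - α + 1 by linarith)]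
  · have h := h3 0
    push_cast at h
    refine core_ineq2 a p q r α β (α - β + 0) ha hp hq hr hα2 hβ2 (by nlinarith) h1 h2 h ?_
    have : 4 * (1 - α ^ 2) * (1 - β ^ 2) - (1 - α ^ 2 - β ^ 2 + (α - β + 0) ^ 2) ^ 2
      = 3 - 4 * (α ^ 2 + β ^ 2 - α * β) := by ring
    rw [this]
    rcases le_total 0 (α * β) with hs | hs
    · rcases le_total (α ^ 2) (β ^ 2) with ht | ht
      · have : α ^ 2 ≤ α * β := by
          have h7 := mul_le_mul_of_nonneg_left ht (sq_nonneg α)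
          have : (α ^ 2) ^ 2 ≤ (α * β) ^ 2 := by linarith [mul_pow α β 2]
          exact (pow_le_pow_iff_left₀ (sq_nonneg α) hs (by norm_num)).1 this
        linarith
      · have : β ^ 2 ≤ α * β := by
          have h7 := mul_le_mul_of_nonneg_left ht (sq_nonneg β)
          have : (β ^ 2) ^ 2 ≤ (α * β) ^ 2 := by linarith [mul_pow α β 2]
          exact (pow_le_pow_iff_left₀ (sq_nonneg β) hs (by norm_num)).1 this
        linarith
    · nlinarith

lemma bin_red (A B C : ℝ) (hA : 0 < A) (hD : 0 < A * C - B ^ 2) :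
    ∃ p q r s : ℤ, (p * s - q * r = 1 ∨ p * s - q * r = -1) ∧
      0 ≤ A * p * r + B * (p * s + q * r) + C * q * s ∧
      A * p * r + B * (p * s + q * r) + C * q * s ≤ A * p ^ 2 + 2 * B * p * q + C * q ^ 2 ∧
      A * p * r + B * (p * s + q * r) + C * q * s ≤ A * r ^ 2 + 2 * B * r * s + C * s ^ 2 := by
  set Δ := A * C - B ^ 2 with hΔ
  have hs : Real.sqrt Δ ^ 2 = Δ := Real.sq_sqrt hD.le
  let z : UpperHalfPlane := ⟨⟨B / A, Real.sqrt Δ / A⟩, by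
    have := Real.sqrt_pos.2 hD
    show 0 < Real.sqrt Δ / A
    positivity⟩
  obtain ⟨g, hg1, hg2⟩ := ModularGroup.exists_smul_mem_fd z
  have hdet := g.det_coe
  rw [Matrix.det_fin_two] at hdet
  set a := g.1 0 0 with ha
  set b := g.1 0 1 with hb
  set c := g.1 1 0 with hc
  set d := g.1 1 1 with hd
  have hz := UpperHalfPlane.specialLinearGroup_apply g z
  have e : ((g • z : UpperHalfPlane) : ℂ) = (a * z + b) / (c * z + d) := by
    rw [hz]; simp [a, b, c, d]
  set w1 : ℂ := a * z + b with hw1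
  set w2 : ℂ := c * z + d with hw2
  have zr : z.re = B / A := rfl
  have zi : z.im = Real.sqrt Δ / A := rfl
  have r1 : w1.re = a * (B / A) + b := by simp [hw1, zr]
  have i1 : w1.im = a * (Real.sqrt Δ / A) := by simp [hw1, zi]
  have r2 : w2.re = c * (B / A) + d := by simp [hw2, zr]
  have i2 : w2.im = c * (Real.sqrt Δ / A) := by simp [hw2, zi]
  have n1 : A * Complex.normSq w1 = A * b ^ 2 + 2 * B * b * a + C * a ^ 2 := by
    rw [Complex.normSq_apply, r1, i1]
    field_simp
    linear_combination a ^ 2 * hs + a ^ 2 * hΔ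
  have n2 : A * Complex.normSq w2 = A * d ^ 2 + 2 * B * d * c + C * c ^ 2 := by
    rw [Complex.normSq_apply, r2, i2]
    field_simp
    linear_combination c ^ 2 * hs + c ^ 2 * hΔ
  have n12 : A * (w1.re * w2.re + w1.im * w2.im) =
      A * d * b + B * (d * a + c * b) + C * c * a := by
    rw [r1, r2, i1, i2]
    field_simp
    linear_combination a * c * hs + a * c * hΔ
  have hw2pos : 0 < Complex.normSq w2 := by
    rw [Complex.normSq_pos]
    intro h0
    have hh : ((g • z : UpperHalfPlane) : ℂ) = 0 := by rw [e, h0, div_zero]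
    exact UpperHalfPlane.ne_zero _ hh
  have f1 : Complex.normSq w2 ≤ Complex.normSq w1 := by
    rw [e, Complex.normSq_div, le_div_iff₀ hw2pos] at hg1
    linarith
  have f2 : 2 * |w1.re * w2.re + w1.im * w2.im| ≤ Complex.normSq w2 := by
    have hre : (g • z).re = (w1.re * w2.re + w1.im * w2.im) / Complex.normSq w2 := by
      rw [← UpperHalfPlane.coe_re, e, Complex.div_re]; ring
    rw [hre, abs_div, abs_of_pos hw2pos, div_le_iff₀ hw2pos] at hg2
    linarith
  have f1' := mul_le_mul_of_nonneg_left f1 hA.le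
  rw [n1, n2] at f1'
  have f2' := mul_le_mul_of_nonneg_left f2 hA.le
  rw [n2, show A * (2 * |w1.re * w2.re + w1.im * w2.im|) = 2 * (|A| * |w1.re * w2.re + w1.im * w2.im|) by rw [abs_of_pos hA]; ring, ← abs_mul, n12] at f2'
  have hpos : 0 ≤ A * d ^ 2 + 2 * B * d * c + C * c ^ 2 := by rw [← n2]; positivity
  rcases le_total 0 (A * d * b + B * (d * a + c * b) + C * c * a) with hB | hB
  · rw [abs_of_nonneg hB] at f2'
    exact ⟨d, c, b, a, Or.inl (by linarith), hB, by linarith, by linarith⟩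
  · rw [abs_of_nonpos hB] at f2'
    refine ⟨d, c, -b, -a, Or.inr (by linarith), ?_, ?_, ?_⟩ <;> push_cast <;> linarith

lemma gamma3 (a x y A B C : ℝ) (ha : 0 < a) (hA : 0 < A) (hD : 0 < A * C - B ^ 2)
    (H : ∀ i j n : ℤ, ¬ (i = 0 ∧ j = 0 ∧ n = 0) →
      a ≤ a * (i + x * j + y * n) ^ 2 + (A * j ^ 2 + 2 * B * j * n + C * n ^ 2)) :
    a ^ 2 ≤ 2 * (A * C - B ^ 2) := by
  obtain ⟨p, q, r, s, hdet, h1, h2, h3⟩ := bin_red A B C hA hD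
  set A' := A * p ^ 2 + 2 * B * p * q + C * q ^ 2 with hA'
  set B' := A * p * r + B * (p * s + q * r) + C * q * s with hB'
  set C' := A * r ^ 2 + 2 * B * r * s + C * s ^ 2 with hC'
  set x' := x * p + y * q with hx'
  set y' := x * r + y * s with hy'
  have hdet2 : ((p : ℝ) * s - q * r) ^ 2 = 1 := by
    rcases hdet with h | h
    · have : (p : ℝ) * s - q * r = 1 := by exact_mod_cast h
      rw [this]; norm_num
    · have : (p : ℝ) * s - q * r = -1 := by exact_mod_cast h
      rw [this]; norm_num
  have hdd : A * C - B ^ 2 = A' * C' - B' ^ 2 := by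
    have : A' * C' - B' ^ 2 = (A * C - B ^ 2) * ((p : ℝ) * s - q * r) ^ 2 := by
      rw [hA', hB', hC']; ring
    rw [this, hdet2, mul_one]
  have nz1 : ∀ m n : ℤ, ¬ (m = 0 ∧ n = 0) → ¬ (p * m + r * n = 0 ∧ q * m + s * n = 0) := by
    rintro m n hmn ⟨e1, e2⟩
    apply hmn
    have e3 : (p * s - q * r) * m = 0 := by linear_combination s * e1 - r * e2
    have e4 : (p * s - q * r) * n = 0 := by linear_combination p * e2 - q * e1
    rcases hdet with h | h <;> rw [h] at e3 e4 <;> constructor <;> linarith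
  have H' : ∀ i m n : ℤ, ¬ (m = 0 ∧ n = 0) →
      a ≤ a * (i + x' * m + y' * n) ^ 2 + (A' * m ^ 2 + 2 * B' * m * n + C' * n ^ 2) := by
    intro i m n hmn
    have := H i (p * m + r * n) (q * m + s * n) (fun h => nz1 m n hmn h.2)
    push_cast at this
    refine this.trans (le_of_eq ?_)
    rw [hA', hB', hC', hx', hy']; ring
  have k1 := H' (-round x') 1 0 (by simp)
  have k2 := H' (-round y') 0 1 (by simp)
  have k3 := fun e : ℤ => H' (-round x' + round y' + e) 1 (-1) (by simp)
  rw [hdd]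
  have := core_ineq3 a B' (A' - B') (C' - B') (x' - round x') (y' - round y') ha h1
    (by linarith) (by linarith) (abs_sub_round x') (abs_sub_round y')
    (by push_cast at k1; refine k1.trans (le_of_eq ?_); ring)
    (by push_cast at k2; refine k2.trans (le_of_eq ?_); ring)
    (by intro e; have := k3 e; push_cast at this; refine this.trans (le_of_eq ?_); ring)
  refine this.trans (le_of_eq ?_); ring

/-- one factor of `HNorm` -/
def qq (c d x y : ℝ) : ℝ := (c * x + d) ^ 2 + c ^ 2 * y ^ 2

lemma HNorm_eq (c d : ℝ × ℝ) (p : Pt) :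
    HNorm c d p = qq c.1 d.1 (x1 p) (y1 p) * qq c.2 d.2 (x2 p) (y2 p) := rfl

lemma qq_nonneg (c d x y : ℝ) : 0 ≤ qq c d x y := by unfold qq; positivity

lemma qq_pos (c d x y : ℝ) (hy : 0 < y) (h : ¬ (c = 0 ∧ d = 0)) : 0 < qq c d x y := by
  unfold qq
  by_cases hc : c = 0
  · subst hc
    have : d ≠ 0 := fun h' => h ⟨rfl, h'⟩
    simp; positivity
  · positivity

lemma qq_smul (u c d x y : ℝ) : qq (u * c) (u * d) x y = u ^ 2 * qq c d x y := by
  unfold qq; ring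

lemma qq_bound (c d x y K : ℝ) (hy : 0 < y) (h : qq c d x y ≤ K) :
    |c| ≤ (K + 1) / y ∧ |d| ≤ K + 1 + (K + 1) / y * |x| := by
  have hK : 0 ≤ K := (qq_nonneg c d x y).trans h
  unfold qq at h
  have h1 : |c * y| ≤ K + 1 := by
    apply abs_le_of_sq_le_sq _ (by linarith)
    nlinarith [sq_nonneg (c * x + d)]
  have h2 : |c * x + d| ≤ K + 1 := by
    apply abs_le_of_sq_le_sq _ (by linarith)
    nlinarith [sq_nonneg (c * y)]
  rw [abs_mul, abs_of_pos hy] at h1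
  have h3 : |c| ≤ (K + 1) / y := by rwa [le_div_iff₀ hy]
  refine ⟨h3, ?_⟩
  have : d = (c * x + d) - c * x := by ring
  rw [this]
  have h4 := abs_sub (c * x + d) (c * x)
  rw [abs_mul] at h4
  have := mul_le_mul_of_nonneg_right h3 (abs_nonneg x)
  linarith

lemma pair_fin (k : ℕ) (hk1 : 1 < k) (p : Pt) (hp : p ∈ HH) (K : ℝ) :
    {cd : R k × R k | qq cd.1.1.1 cd.2.1.1 (x1 p) (y1 p) ≤ K ∧
      qq cd.1.1.2 cd.2.1.2 (x2 p) (y2 p) ≤ K}.Finite := by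
  set M := max (max ((K + 1) / y1 p) (K + 1 + (K + 1) / y1 p * |x1 p|))
    (max ((K + 1) / y2 p) (K + 1 + (K + 1) / y2 p * |x2 p|)) with hM
  refine ((R_fin k hk1 M).prod (R_fin k hk1 M)).subset ?_
  rintro ⟨c, d⟩ ⟨h1, h2⟩
  have b1 := qq_bound _ _ _ _ _ hp.1 h1
  have b2 := qq_bound _ _ _ _ _ hp.2 h2
  have m1 : (K + 1) / y1 p ≤ M := (le_max_left _ _).trans (le_max_left _ _)
  have m2 : K + 1 + (K + 1) / y1 p * |x1 p| ≤ M := (le_max_right _ _).trans (le_max_left _ _)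
  have m3 : (K + 1) / y2 p ≤ M := (le_max_left _ _).trans (le_max_right _ _)
  have m4 : K + 1 + (K + 1) / y2 p * |x2 p| ≤ M := (le_max_right _ _).trans (le_max_right _ _)
  exact ⟨⟨b1.1.trans m1, b2.1.trans m3⟩, ⟨b1.2.trans m2, b2.2.trans m4⟩⟩

lemma pair_ne (k : ℕ) (hk : Squarefree k) (hk1 : 1 < k) (cd : R k × R k) (h : cd ≠ 0) :
    ¬ (cd.1.1.1 = 0 ∧ cd.2.1.1 = 0) ∧ ¬ (cd.1.1.2 = 0 ∧ cd.2.1.2 = 0) := by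
  obtain ⟨c, d⟩ := cd
  by_cases hc : c = 0
  · have hd : d ≠ 0 := by rintro rfl; exact h (by rw [hc]; rfl)
    have := R_ne k hk hk1 d hd
    exact ⟨fun h' => this.1 h'.2, fun h' => this.2 h'.2⟩
  · have := R_ne k hk hk1 c hc
    exact ⟨fun h' => this.1 h'.1, fun h' => this.2 h'.1⟩

lemma HNorm_pos (k : ℕ) (hk : Squarefree k) (hk1 : 1 < k) (cd : R k × R k) (h : cd ≠ 0)
    (p : Pt) (hp : p ∈ HH) : 0 < HNorm cd.1.1 cd.2.1 p := by
  have := pair_ne k hk hk1 cd h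
  exact mul_pos (qq_pos _ _ _ _ hp.1 this.1) (qq_pos _ _ _ _ hp.2 this.2)

lemma HNorm_smul (k : ℕ) (g c d : R k) (p : Pt) :
    HNorm (g * c : R k).1 (g * d : R k).1 p = Nm k g ^ 2 * HNorm c.1 d.1 p := by
  simp only [HNorm, Nm]; simp; ring

lemma bezout (k : ℕ) (hk : Squarefree k) (hk1 : 1 < k) (hPID : IsPrincipalIdealRing (R k))
    (c d : R k) (h : ¬ (c = 0 ∧ d = 0)) :
    ∃ g c1 d1 a1 b1 : R k, g ≠ 0 ∧ c = g * c1 ∧ d = g * d1 ∧ a1 * d1 - b1 * c1 = 1 := by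
  obtain ⟨g, hg⟩ := (hPID.principal (Ideal.span {c, d})).principal
  have hg' : Ideal.span {c, d} = Ideal.span {g} := hg
  have hc : c ∈ Ideal.span {g} := by rw [← hg']; exact Ideal.subset_span (by simp)
  have hd : d ∈ Ideal.span {g} := by rw [← hg']; exact Ideal.subset_span (by simp)
  have hgg : g ∈ Ideal.span {c, d} := by rw [hg']; exact Ideal.mem_span_singleton_self g
  rw [Ideal.mem_span_singleton] at hc hd
  rw [Ideal.mem_span_pair] at hgg
  obtain ⟨c1, hc⟩ := hc
  obtain ⟨d1, hd⟩ := hd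
  obtain ⟨α, β, hab⟩ := hgg
  have hg0 : g ≠ 0 := by
    rintro rfl
    exact h ⟨by rw [hc, zero_mul], by rw [hd, zero_mul]⟩
  refine ⟨g, c1, d1, β, -α, hg0, hc, hd, ?_⟩
  apply R_cancel k hk hk1 g _ _ hg0
  rw [hc, hd] at hab
  linear_combination hab

lemma four_le_sq (m : ℝ) (h : 2 ≤ m) : 4 ≤ m ^ 2 := by nlinarith

lemma amgm (x y : ℝ) (hx : 0 ≤ x) (hy : 0 ≤ y) (h : 1 ≤ x * y) : 2 ≤ x + y := by
  nlinarith [sq_nonneg (x - y)]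

lemma gram_id (g1 g2 f1 f2 P Q S P' Q' S' h m : ℝ) (e1 : P * S - Q ^ 2 = h)
    (e2 : P' * S' - Q' ^ 2 = h) (hm : m = g1 ^ 2 * P + g2 ^ 2 * P') (hm0 : m ≠ 0) :
    (f1 ^ 2 * P + f2 ^ 2 * P' - (f1 * g1 * P + f2 * g2 * P') ^ 2 / m) *
      (g2 ^ 2 * S + g1 ^ 2 * S' - (g1 * g2 * (Q + Q')) ^ 2 / m) -
      (f1 * g2 * Q + f2 * g1 * Q' - (f1 * g1 * P + f2 * g2 * P') * (g1 * g2 * (Q + Q')) / m) ^ 2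
      = (f1 * g2 - f2 * g1) ^ 2 * h := by
  have h1 : ∀ A B C b d : ℝ, (A - b ^ 2 / m) * (C - d ^ 2 / m) - (B - b * d / m) ^ 2
      = (m * A * C + 2 * B * b * d - A * d ^ 2 - C * b ^ 2 - m * B ^ 2) / m := by
    intros; field_simp; ring
  rw [h1, div_eq_iff hm0, hm]
  linear_combination (f1 * g2 - f2 * g1) ^ 2 * (P' * g2 ^ 2 * e1 + P * g1 ^ 2 * e2)

set_option maxHeartbeats 1600000 in
lemma height (k : ℕ) (hk : Squarefree k) (hk1 : 1 < k) (hPID : IsPrincipalIdealRing (R k))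
    (p : Pt) (hp : p ∈ HH) (H : ∀ cd : R k × R k, cd ≠ 0 → 1 ≤ HNorm cd.1.1 cd.2.1 p) :
    (k0 k) ^ 2 / (2 * k) ≤ y1 p * y2 p := by
  obtain ⟨hy1, hy2⟩ := hp
  set t := Real.sqrt (y2 p / y1 p) with ht
  have ht0 : 0 < t := Real.sqrt_pos.2 (div_pos hy2 hy1)
  have ht2 : t ^ 2 = y2 p / y1 p := Real.sq_sqrt (div_pos hy2 hy1).le
  set q : R k × R k → ℝ := fun cd =>
    t * qq cd.1.1.1 cd.2.1.1 (x1 p) (y1 p) + t⁻¹ * qq cd.1.1.2 cd.2.1.2 (x2 p) (y2 p) with hq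
  -- minimum
  obtain ⟨v, hv0, hvmin⟩ : ∃ v : R k × R k, v ≠ 0 ∧ ∀ w : R k × R k, w ≠ 0 → q v ≤ q w := by
    set M := q (0, 1) with hM
    have hM0 : 0 ≤ M := by
      have := qq_nonneg; simp only [hM, hq]
      exact add_nonneg (mul_nonneg ht0.le (this _ _ _ _)) (mul_nonneg (inv_pos.2 ht0).le (this _ _ _ _))
    have hfin : {w : R k × R k | w ≠ 0 ∧ q w ≤ M}.Finite := by
      refine (pair_fin k hk1 p ⟨hy1, hy2⟩ (t⁻¹ * M + t * M)).subset ?_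
      rintro w ⟨-, hw⟩
      have n1 := qq_nonneg w.1.1.1 w.2.1.1 (x1 p) (y1 p)
      have n2 := qq_nonneg w.1.1.2 w.2.1.2 (x2 p) (y2 p)
      simp only [hq] at hw
      have ti : 0 < t⁻¹ := inv_pos.2 ht0
      have m1 := mul_nonneg ht0.le n1
      have m2 := mul_nonneg ti.le n2
      have m3 := mul_nonneg ht0.le hM0
      have m4 := mul_nonneg ti.le hM0
      constructor
      · have h5 : t * qq w.1.1.1 w.2.1.1 (x1 p) (y1 p) ≤ M := by linarith
        have h6 := mul_le_mul_of_nonneg_left h5 ti.le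
        rw [← mul_assoc, inv_mul_cancel₀ ht0.ne', one_mul] at h6
        linarith
      · have h5 : t⁻¹ * qq w.1.1.2 w.2.1.2 (x2 p) (y2 p) ≤ M := by linarith
        have h6 := mul_le_mul_of_nonneg_left h5 ht0.le
        rw [← mul_assoc, mul_inv_cancel₀ ht0.ne', one_mul] at h6
        linarith
    have h01 : ((0, 1) : R k × R k) ≠ 0 := by
      intro h; have := congrArg Prod.snd h
      have := congrArg (fun z : R k => z.1.1) this
      simp at this
    obtain ⟨v, hv, hmin⟩ := Set.exists_min_image _ q hfin ⟨(0, 1), h01, le_refl _⟩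
    refine ⟨v, hv.1, fun w hw => ?_⟩
    by_cases hc : q w ≤ M
    · exact hmin w ⟨hw, hc⟩
    · exact hv.2.trans (le_of_not_ge hc)
  obtain ⟨gg, c, d, a, b, hgg, hvc, hvd, hdet⟩ := bezout k hk hk1 hPID v.1 v.2
    (fun h => hv0 (Prod.ext h.1 h.2))
  obtain ⟨A0, B0, hA0, hB0⟩ := R_rep k gg
  have hAB : ¬ (A0 = 0 ∧ B0 = 0) := by
    rintro ⟨rfl, rfl⟩
    apply (R_ne k hk hk1 gg hgg).1
    rw [hA0]; simp
  obtain ⟨a', b', l, hl, hab, hlA, hlB⟩ : ∃ a' b' l : ℤ, 1 ≤ l ∧ IsCoprime a' b' ∧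
      A0 = l * a' ∧ B0 = l * b' := by
    have hpos : 0 < Int.gcd A0 B0 := by
      rw [Int.gcd_pos_iff]; tauto
    obtain ⟨a', b', h1, h2, h3⟩ := Int.exists_gcd_one hpos
    refine ⟨a', b', Int.gcd A0 B0, by exact_mod_cast hpos, ?_, by rw [mul_comm]; exact h2,
      by rw [mul_comm]; exact h3⟩
    rw [Int.isCoprime_iff_gcd_eq_one]; exact h1
  obtain ⟨y', x', hxy⟩ := hab
  obtain ⟨g, hg1, hg2⟩ := R_mk k a' b'
  obtain ⟨f, hf1, hf2⟩ := R_mk k (-x') y'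
  obtain ⟨gc, hgc1, hgc2⟩ := R_conj k g
  have hxyR : (y' : ℝ) * a' + x' * b' = 1 := by exact_mod_cast hxy
  have hfg : (f.1.1 * g.1.2 - f.1.2 * g.1.1) = omg k - omg' k := by
    rw [hf1, hf2, hg1, hg2]; push_cast
    linear_combination (omg k - omg' k) * hxyR
  have hg0 : g ≠ 0 := by
    rintro rfl
    have h1 := om_indep k hk hk1 a' b' (Or.inl (by rw [← hg1]; rfl))
    rw [h1.1, h1.2] at hxy; simp at hxy
  -- components
  set P := t * qq c.1.1 d.1.1 (x1 p) (y1 p) with hP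
  set P' := t⁻¹ * qq c.1.2 d.1.2 (x2 p) (y2 p) with hP'
  set S := t * qq a.1.1 b.1.1 (x1 p) (y1 p) with hS
  set S' := t⁻¹ * qq a.1.2 b.1.2 (x2 p) (y2 p) with hS'
  set Q := t * ((a.1.1 * x1 p + b.1.1) * (c.1.1 * x1 p + d.1.1) + a.1.1 * c.1.1 * y1 p ^ 2) with hQ
  set Q' := t⁻¹ * ((a.1.2 * x2 p + b.1.2) * (c.1.2 * x2 p + d.1.2) + a.1.2 * c.1.2 * y2 p ^ 2) with hQ'
  have hd1 : a.1.1 * d.1.1 - b.1.1 * c.1.1 = 1 := by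
    have := congrArg (fun z : R k => z.1.1) hdet; simpa using this
  have hd2 : a.1.2 * d.1.2 - b.1.2 * c.1.2 = 1 := by
    have := congrArg (fun z : R k => z.1.2) hdet; simpa using this
  have e1 : P * S - Q ^ 2 = y1 p * y2 p := by
    have : P * S - Q ^ 2 = t ^ 2 * y1 p ^ 2 * (a.1.1 * d.1.1 - b.1.1 * c.1.1) ^ 2 := by
      rw [hP, hS, hQ]; unfold qq; ring
    rw [this, hd1, ht2]; field_simp
  have e2 : P' * S' - Q' ^ 2 = y1 p * y2 p := by
    have : P' * S' - Q' ^ 2 = (t ^ 2)⁻¹ * y2 p ^ 2 * (a.1.2 * d.1.2 - b.1.2 * c.1.2) ^ 2 := by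
      rw [hP', hS', hQ']; unfold qq; ring
    rw [this, hd2, ht2]; field_simp
  have hqf : ∀ ξ η : R k, q (ξ * a + η * c, ξ * b + η * d) =
      ξ.1.1 ^ 2 * S + 2 * ξ.1.1 * η.1.1 * Q + η.1.1 ^ 2 * P +
      (ξ.1.2 ^ 2 * S' + 2 * ξ.1.2 * η.1.2 * Q' + η.1.2 ^ 2 * P') := by
    intro ξ η
    simp only [hq, hP, hP', hQ, hQ', hS, hS', qq]
    simp
    ring
  set m := g.1.1 ^ 2 * P + g.1.2 ^ 2 * P' with hm
  have hvm : m ≤ q v := by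
    have h1 : v = ((0 : R k) * a + gg * c, (0 : R k) * b + gg * d) := by
      apply Prod.ext
      · simp [hvc]
      · simp [hvd]
    have h2 : q v = (l : ℝ) ^ 2 * m := by
      rw [h1, hqf, hm, hA0, hB0, hg1, hg2, hlA, hlB]; push_cast; simp; ring
    have h3 : (1 : ℝ) ≤ (l : ℝ) := by exact_mod_cast hl
    have hP0 : 0 ≤ P := mul_nonneg ht0.le (qq_nonneg _ _ _ _)
    have hP0' : 0 ≤ P' := mul_nonneg (inv_pos.2 ht0).le (qq_nonneg _ _ _ _)
    have h4 : 0 ≤ m := by rw [hm]; positivity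
    rw [h2]
    exact le_mul_of_one_le_left h4 (one_le_pow₀ h3)
  have hpair : ∀ ξ η : R k, ¬ (ξ = 0 ∧ η = 0) → m ≤
      ξ.1.1 ^ 2 * S + 2 * ξ.1.1 * η.1.1 * Q + η.1.1 ^ 2 * P +
      (ξ.1.2 ^ 2 * S' + 2 * ξ.1.2 * η.1.2 * Q' + η.1.2 ^ 2 * P') := by
    intro ξ η h
    rw [← hqf]
    refine hvm.trans (hvmin _ ?_)
    intro h0
    have h1 : ξ * a + η * c = 0 := congrArg Prod.fst h0
    have h2 : ξ * b + η * d = 0 := congrArg Prod.snd h0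
    exact h ⟨by linear_combination d * h1 - c * h2 - ξ * hdet,
      by linear_combination a * h2 - b * h1 - η * hdet⟩
  have hm2 : 2 ≤ m := by
    have h1 : (g * c, g * d) ≠ (0 : R k × R k) := by
      intro h0
      have h1 : g * c = 0 := congrArg Prod.fst h0
      have h2 : g * d = 0 := congrArg Prod.snd h0
      exact hg0 (by linear_combination a * h2 - b * h1 - g * hdet)
    have h2 := H _ h1
    have h3 : m = t * qq (g * c : R k).1.1 (g * d : R k).1.1 (x1 p) (y1 p) +
      t⁻¹ * qq (g * c : R k).1.2 (g * d : R k).1.2 (x2 p) (y2 p) := by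
      rw [hm, hP, hP']; simp [qq_smul]; ring
    rw [HNorm_eq] at h2
    rw [h3]
    simp only at h2
    set X := qq (g * c : R k).1.1 (g * d : R k).1.1 (x1 p) (y1 p)
    set Y := qq (g * c : R k).1.2 (g * d : R k).1.2 (x2 p) (y2 p)
    have hX : 0 ≤ X := qq_nonneg _ _ _ _
    have hY : 0 ≤ Y := qq_nonneg _ _ _ _
    have h5 : (t * X) * (t⁻¹ * Y) = X * Y := by field_simp
    have h6 := mul_nonneg ht0.le hX
    have h7 := mul_nonneg (inv_pos.2 ht0).le hY
    exact amgm _ _ h6 h7 (h5 ▸ h2)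
  have hm0 : 0 < m := by linarith
  have hG := gram_id g.1.1 g.1.2 f.1.1 f.1.2 P Q S P' Q' S' _ m e1 e2 hm hm0.ne'
  rw [hfg] at hG
  have hD := om_sub_pos k hk1
  have hh0 : 0 < y1 p * y2 p := mul_pos hy1 hy2
  have hPpos : 0 < P := by
    apply mul_pos ht0; apply qq_pos _ _ _ _ hy1
    rintro ⟨h1, h2⟩; rw [h1, h2] at hd1; simp at hd1
  have hPpos' : 0 < P' := by
    apply mul_pos (inv_pos.2 ht0); apply qq_pos _ _ _ _ hy2
    rintro ⟨h1, h2⟩; rw [h1, h2] at hd2; simp at hd2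
  have hApos : 0 < f.1.1 ^ 2 * P + f.1.2 ^ 2 * P' - (f.1.1 * g.1.1 * P + f.1.2 * g.1.2 * P') ^ 2 / m := by
    have : f.1.1 ^ 2 * P + f.1.2 ^ 2 * P' - (f.1.1 * g.1.1 * P + f.1.2 * g.1.2 * P') ^ 2 / m
      = P * P' * (f.1.1 * g.1.2 - f.1.2 * g.1.1) ^ 2 / m := by
      rw [eq_div_iff hm0.ne', sub_mul, div_mul_cancel₀ _ hm0.ne', hm]; ring
    rw [this, hfg]; positivity
  have := gamma3 m ((f.1.1 * g.1.1 * P + f.1.2 * g.1.2 * P') / m)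
    ((g.1.1 * g.1.2 * (Q + Q')) / m) _ _ _ hm0 hApos (by rw [hG]; positivity) ?_
  · rw [hG, om_sub_sq] at this
    have hk0 := k0_pos k
    have hkp : (0 : ℝ) < k := by positivity
    have h8 : (4 : ℝ) ≤ m ^ 2 := four_le_sq m hm2
    have h9 := h8.trans this
    rw [← div_le_iff₀' (by norm_num)] at h9
    have h4 : 2 ≤ 4 * k / (k0 k) ^ 2 * (y1 p * y2 p) := le_trans (by norm_num) h9
    rw [div_le_iff₀ (by positivity)]
    have h5 := mul_le_mul_of_nonneg_left h4 (sq_nonneg (k0 k))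
    have h6 : k0 k ^ 2 * (4 * k / (k0 k) ^ 2 * (y1 p * y2 p)) = 4 * k * (y1 p * y2 p) := by
      field_simp
    linarith
  · intro i j n hijn
    have := hpair ((n : R k) * gc) ((i : R k) * g + (j : R k) * f) ?_
    · refine this.trans (le_of_eq ?_)
      simp [hgc1, hgc2]
      have h1 : ∀ A B C b d : ℝ, m * ((i : ℝ) + b / m * j + d / m * n) ^ 2 +
          ((A - b ^ 2 / m) * j ^ 2 + 2 * (B - b * d / m) * j * n + (C - d ^ 2 / m) * n ^ 2)
          = m * i ^ 2 + A * j ^ 2 + C * n ^ 2 + 2 * b * i * j + 2 * d * i * n + 2 * B * j * n := by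
        intros; field_simp; ring
      rw [h1, hm]; ring
    · rintro ⟨h1, h2⟩
      apply hijn
      have hgc0 : gc.1.1 ≠ 0 := by rw [hgc1]; exact (R_ne k hk hk1 g hg0).2
      have hn : n = 0 := by
        have := congrArg (fun z : R k => z.1.1) h1
        simp [hgc0] at this
        exact this
      have h3 := congrArg (fun z : R k => z.1.1) h2
      simp [hg1, hf1] at h3
      have h4 := om_indep k hk hk1 (i * a' - j * x') (i * b' + j * y') (Or.inl (by
        push_cast; linear_combination h3))
      refine ⟨?_, ?_, hn⟩
      · linear_combination y' * h4.1 + x' * h4.2 - i * hxy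
      · linear_combination a' * h4.2 - b' * h4.1 - j * hxy

lemma X_bound (N B ε X1 X2 a b : ℝ) (hN : 0 < N) (hB : 0 < B) (hε : 0 < ε) (ha : 0 < a)
    (hb : 0 < b) (h : N * ((X1 ^ 2 + a ^ 2) * (X2 ^ 2 + b ^ 2)) = 1) (hBh : B ≤ a * b)
    (hab : a ≤ ε ^ 2 * b) :
    N * B ^ 2 ≤ 1 ∧ |X1| ≤ ε * Real.sqrt (1 / (N * B) - B) ∧
      (X2 ≠ 0 → |X1| < ε * Real.sqrt (1 / (N * B) - B)) := by
  have h0 : (X1 ^ 2 + a ^ 2) * (X2 ^ 2 + b ^ 2) = 1 / N := by field_simp; linarith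
  set h' := a * b with hh'
  have hpos : 0 < h' := mul_pos ha hb
  have e1 : X1 ^ 2 * b ^ 2 + a ^ 2 * X2 ^ 2 ≤ 1 / N - h' ^ 2 := by
    rw [← h0, hh']; nlinarith [mul_nonneg (sq_nonneg X1) (sq_nonneg X2)]
  have e2 : h' ≤ ε ^ 2 * b ^ 2 := by rw [hh']; nlinarith
  have hn : N * h' ^ 2 ≤ 1 := by
    have : h' ^ 2 ≤ 1 / N := by nlinarith [mul_nonneg (sq_nonneg X1) (sq_nonneg b), mul_nonneg (sq_nonneg a) (sq_nonneg X2)]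
    rw [le_div_iff₀ hN] at this; linarith
  have hsq : B ^ 2 ≤ h' ^ 2 := pow_le_pow_left₀ hB.le hBh 2
  have e3 : 1 / (N * h') - h' ≤ 1 / (N * B) - B := by
    have : 1 / (N * h') ≤ 1 / (N * B) := one_div_le_one_div_of_le (mul_pos hN hB) (mul_le_mul_of_nonneg_left hBh hN.le)
    linarith
  have e4 : 1 / N - h' ^ 2 = h' * (1 / (N * h') - h') := by field_simp
  have key : X1 ^ 2 * h' + ε ^ 2 * (a ^ 2 * X2 ^ 2) ≤ ε ^ 2 * (1 / (N * h') - h') * h' := by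
    have h1 := mul_le_mul_of_nonneg_left e2 (sq_nonneg X1)
    have h2 := mul_le_mul_of_nonneg_left e1 (sq_nonneg ε)
    rw [e4] at h2
    nlinarith
  have e5 : ε ^ 2 * (1 / (N * h') - h') ≤ ε ^ 2 * (1 / (N * B) - B) :=
    mul_le_mul_of_nonneg_left e3 (sq_nonneg ε)
  have f1 : X1 ^ 2 ≤ ε ^ 2 * (1 / (N * h') - h') := by
    have : 0 ≤ ε ^ 2 * (a ^ 2 * X2 ^ 2) := by positivity
    exact le_of_mul_le_mul_right (by linarith) hpos
  have conv : ε * Real.sqrt (1 / (N * B) - B) = Real.sqrt (ε ^ 2 * (1 / (N * B) - B)) := by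
    rw [Real.sqrt_mul (sq_nonneg ε), Real.sqrt_sq hε.le]
  rw [conv]
  refine ⟨?_, Real.abs_le_sqrt (f1.trans e5), ?_⟩
  · exact (mul_le_mul_of_nonneg_left hsq hN.le).trans hn
  · intro hX
    have f2 : X1 ^ 2 < ε ^ 2 * (1 / (N * h') - h') := by
      have : 0 < ε ^ 2 * (a ^ 2 * X2 ^ 2) := by positivity
      exact lt_of_mul_lt_mul_right (by linarith) hpos.le
    apply Real.lt_sqrt_of_sq_lt
    rw [sq_abs]; exact f2.trans_le e5

lemma nogo (k : ℕ) (hk : Squarefree k) (hk1 : 1 < k) (c d κ : R k) (hc : c ≠ 0)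
    (hcop : Ideal.span {c, d} = ⊤) (h2 : 2 * d = κ * c)
    (hκ : k = 2 → ∃ r, κ = (omR k - 1) * r)
    (hN : Nm k c ^ 2 = (2 * k / (k0 k) ^ 2) ^ 2) : False := by
  have h1 : (1 : R k) ∈ Ideal.span {c, d} := by rw [hcop]; trivial
  rw [Ideal.mem_span_pair] at h1
  obtain ⟨α, β, hab⟩ := h1
  set w := 2 * α + β * κ with hw
  have hcw : c * w = 2 := by rw [hw]; linear_combination 2 * hab - β * h2
  obtain ⟨M, hM⟩ := Nm_int k w
  obtain ⟨n, hn⟩ := Nm_int k c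
  have hnM : n * M = 4 := by
    have h4 : Nm k (c * w) = 4 := by
      rw [hcw]
      have a1 : ((2 : R k) : ℝ × ℝ) = 2 := rfl
      simp [Nm, a1]; norm_num
    rw [Nm_mul, hM, hn] at h4
    exact_mod_cast h4
  rw [hn] at hN
  rcases k0_cases k with ⟨e0, e1⟩ | ⟨e0, e1⟩
  · rw [e0] at hN
    have : (4 * n ^ 2 : ℝ) = k ^ 2 := by rw [hN]; ring
    have h5 : 4 * n ^ 2 = (k : ℤ) ^ 2 := by exact_mod_cast this
    have h6 : (k : ℤ) % 2 = 1 := by omega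
    have h7 : Odd ((k : ℤ) ^ 2) := (Int.odd_iff.2 h6).pow
    rw [← h5] at h7
    rw [Int.odd_iff] at h7; omega
  · rw [e0] at hN
    have : (n ^ 2 : ℝ) = 4 * k ^ 2 := by rw [hN]; ring
    have h5 : n ^ 2 = 4 * (k : ℤ) ^ 2 := by exact_mod_cast this
    have h6 : (k : ℤ) ^ 2 * M ^ 2 = 4 := by
      have : n ^ 2 * M ^ 2 = 16 := by rw [← mul_pow, hnM]; norm_num
      rw [h5] at this; linarith
    have hM0 : M ≠ 0 := by rintro rfl; simp at h6
    have hM1 : 1 ≤ M ^ 2 := by have := sq_pos_of_ne_zero hM0; omega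
    have hk2 : k = 2 := by
      have : (k : ℤ) < 3 := by nlinarith
      omega
    obtain ⟨r, hr⟩ := hκ hk2
    have hM2 : M ^ 2 = 1 := by rw [hk2] at h6; push_cast at h6; omega
    have hs : Real.sqrt k * Real.sqrt k = 2 := by
      rw [Real.mul_self_sqrt (by positivity), hk2]; norm_num
    have hρ1 : (omR k - 1 : R k).1.1 = Real.sqrt k := by
      simp [omR, omg, e0]
    have hρ2 : (omR k - 1 : R k).1.2 = - Real.sqrt k := by
      simp [omR, omg', e0]
    have hρ : (omR k - 1) * (omR k - 1) = 2 := by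
      apply R_ext1 k hk hk1
      have : ((omR k - 1) * (omR k - 1) : R k).1.1 = (omR k - 1 : R k).1.1 * (omR k - 1 : R k).1.1 := rfl
      rw [this, hρ1, hs]; rfl
    have hwρ : w = (omR k - 1) * ((omR k - 1) * α + β * r) := by
      rw [hw, hr]; linear_combination - α * hρ
    obtain ⟨j, hj⟩ := Nm_int k ((omR k - 1) * α + β * r)
    have hNρ : Nm k (omR k - 1) = -2 := by
      unfold Nm; rw [hρ1, hρ2]; linarith
    rw [hwρ, Nm_mul, hNρ, hj] at hM
    have h8 : -2 * j = M := by exact_mod_cast hM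
    rw [← h8] at hM2
    have : 4 * j ^ 2 = 1 := by linarith
    omega

lemma st_bd (s t w : ℝ) (hw : 0 < w) (hs : -(1 / 2) ≤ s ∧ s ≤ 1 / 2)
    (ht : -(1 / 2) ≤ t ∧ t ≤ 1 / 2) : |s + t * w| ≤ (1 + w) / 2 ∧
    (|s + t * w| = (1 + w) / 2 → ∃ δ : ℤ, s = δ / 2 ∧ t = δ / 2 ∧ (δ = 1 ∨ δ = -1)) := by
  have h1 : 0 ≤ (1 / 2 - t) * w := mul_nonneg (by linarith [ht.2]) hw.le
  have h2 : 0 ≤ (t + 1 / 2) * w := mul_nonneg (by linarith [ht.1]) hw.le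
  refine ⟨by rw [abs_le]; constructor <;> linarith [hs.1, hs.2], fun h => ?_⟩
  rcases abs_choice (s + t * w) with h' | h'
  · rw [h'] at h
    have a : s = 1 / 2 := by linarith [hs.2]
    have b : (1 / 2 - t) * w = 0 := by linarith [hs.2]
    have c := (mul_eq_zero.1 b).resolve_right hw.ne'
    exact ⟨1, by push_cast; linarith, by push_cast; linarith, Or.inl rfl⟩
  · rw [h'] at h
    have a : s = -(1 / 2) := by linarith [hs.1]
    have b : (t + 1 / 2) * w = 0 := by linarith [hs.1]
    have c := (mul_eq_zero.1 b).resolve_right hw.ne'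
    exact ⟨-1, by push_cast; linarith, by push_cast; linarith, Or.inr rfl⟩

lemma st_bd2 (s t w : ℝ) (hw : w < 0) (hs : -(1 / 2) ≤ s ∧ s ≤ 1 / 2)
    (ht : -(1 / 2) ≤ t ∧ t ≤ 1 / 2) : |s + t * w| ≤ (1 - w) / 2 ∧
    (|s + t * w| = (1 - w) / 2 → ∃ δ : ℤ, s = δ / 2 ∧ t = - δ / 2 ∧ (δ = 1 ∨ δ = -1)) := by
  have h := st_bd s (-t) (-w) (by linarith) hs ⟨by linarith [ht.2], by linarith [ht.1]⟩
  rw [neg_mul_neg, ← sub_eq_add_neg] at h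
  refine ⟨h.1, fun h' => ?_⟩
  obtain ⟨δ, a, b, c⟩ := h.2 h'
  exact ⟨δ, a, by linarith, c⟩

set_option maxHeartbeats 1600000 in
lemma scond (k : ℕ) (hk : Squarefree k) (hk1 : 1 < k) (hPID : IsPrincipalIdealRing (R k))
    (ε : ℝ) (hε : 1 < ε) (p : Pt) (hp : p ∈ HH)
    (H : ∀ cd : R k × R k, cd ≠ 0 → 1 ≤ HNorm cd.1.1 cd.2.1 p)
    (s t : ℝ) (hs : |s| ≤ 1 / 2) (ht : |t| ≤ 1 / 2)
    (hx1 : x1 p = s + t * omg k) (hx2 : x2 p = s + t * omg' k)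
    (hr1 : y1 p ≤ ε ^ 2 * y2 p) (hr2 : y2 p ≤ ε ^ 2 * y1 p)
    (c d : R k) (hc : c ≠ 0) (hcop : Ideal.span {c, d} = ⊤)
    (hn : HNorm c.1 d.1 p = 1) : SCond k ε (c, d) := by
  have hB := height k hk hk1 hPID p hp H
  obtain ⟨hy1, hy2⟩ := hp
  have hk0 := k0_pos k
  have hkp : (0 : ℝ) < k := by positivity
  obtain ⟨hc1, hc2⟩ := R_ne k hk hk1 c hc
  set B := (k0 k) ^ 2 / (2 * k) with hBdef
  have hB0 : 0 < B := by positivity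
  have hBi : 2 * k / (k0 k) ^ 2 = 1 / B := by rw [hBdef]; field_simp
  have hNpos : 0 < Nm k c ^ 2 := by have := Nm_sq k hk hk1 c hc; linarith
  have harg : 2 * k / (Nm k c ^ 2 * (k0 k) ^ 2) - B = 1 / (Nm k c ^ 2 * B) - B := by
    have h3 : Nm k c ≠ 0 := mul_ne_zero hc1 hc2
    rw [hBdef]; field_simp
  set X1 := x1 p + d.1.1 / c.1.1 with hX1
  set X2 := x2 p + d.1.2 / c.1.2 with hX2
  have hn' : Nm k c ^ 2 * ((X1 ^ 2 + y1 p ^ 2) * (X2 ^ 2 + y2 p ^ 2)) = 1 := by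
    rw [← hn]; simp only [HNorm, Nm, hX1, hX2]; field_simp
  have b1 := X_bound _ B ε X1 X2 _ _ hNpos hB0 (by linarith) hy1 hy2 hn' hB hr1
  have b2 := X_bound _ B ε X2 X1 _ _ hNpos hB0 (by linarith) hy2 hy1
    (by rw [← hn']; ring) (by rw [mul_comm]; exact hB) hr2
  have hω := om_pos k
  have hω' := om'_neg k hk1
  rw [abs_le] at hs ht
  have nn : ∀ κ : R k, X1 = 0 → X2 = 0 → 0 < 1 / B →
      (1 / (Nm k c ^ 2 * B) - B ≤ 0) → 2 * d = κ * c →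
      (k = 2 → ∃ r, κ = (omR k - 1) * r) → False := by
    intro κ _ _ _ h4 h5 h6
    refine nogo k hk hk1 c d κ hc hcop h5 h6 ?_
    rw [hBi, div_pow, one_pow, eq_div_iff (by positivity)]
    apply le_antisymm b1.1
    have : 1 / (Nm k c ^ 2 * B) ≤ B := by linarith
    rw [div_le_iff₀ (by positivity)] at this
    linarith
  have hsq0 : X1 = 0 ∨ X2 = 0 → True := fun _ => trivial
  refine ⟨hc, hcop, ?_, ?_, ?_⟩
  · show |Nm k c| ≤ _
    rw [hBi, le_div_iff₀ hB0, ← abs_of_pos hB0, ← abs_mul]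
    apply abs_le_of_sq_le_sq _ (by norm_num)
    rw [mul_pow]; linarith [b1.1]
  · show |d.1.1 / c.1.1| < ε * Real.sqrt (2 * k / (Nm k c ^ 2 * (k0 k) ^ 2) - B) + _
    rw [harg]
    by_contra hcon
    push Not at hcon
    have hdc : d.1.1 / c.1.1 = X1 - x1 p := by rw [hX1]; ring
    rw [hdc] at hcon
    have h3 := abs_sub X1 (x1 p)
    have h4 : |x1 p| ≤ (1 + omg k) / 2 := by
      rw [hx1]; exact (st_bd s t _ hω hs ht).1
    have h5 : X2 = 0 := by
      by_contra h; have := b1.2.2 h; linarith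
    have h6 : |x1 p| = (1 + omg k) / 2 := by linarith [b1.2.1]
    have h7 : |X1| = ε * Real.sqrt (1 / (Nm k c ^ 2 * B) - B) := by linarith [b1.2.1]
    obtain ⟨δ, hδ1, hδ2, hδ3⟩ : ∃ δ : ℤ, s = δ / 2 ∧ t = δ / 2 ∧ (δ = 1 ∨ δ = -1) := by
      exact (st_bd s t _ hω hs ht).2 (by rw [← hx1]; exact h6)
    have h8 : 2 * d = (-(δ : R k) * (1 + omR k)) * c := by
      rw [← sub_eq_zero]
      by_contra h9
      apply (R_ne k hk hk1 _ h9).2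
      have a1 : ((2 : R k) : ℝ × ℝ) = 2 := rfl
      simp [omR, a1]
      rw [hX2, hx2, hδ1, hδ2] at h5
      field_simp at h5
      linarith
    have h9 : X1 = 0 := by
      have := congrArg (fun z : R k => z.1.1) h8
      have a1 : ((2 : R k) : ℝ × ℝ) = 2 := rfl
      simp [omR, a1] at this
      rw [hX1, hx1, hδ1, hδ2]
      field_simp
      linarith
    refine nn _ h9 h5 (by positivity) ?_ h8 ?_
    · rw [h9, abs_zero] at h7
      have := mul_eq_zero.1 h7.symm
      rcases this with h | h
      · linarith
      · exact Real.sqrt_eq_zero'.1 h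
    · intro hk2
      refine ⟨-(δ : R k) * omR k, ?_⟩
      apply R_ext1 k hk hk1
      have e0 : k0 k = 1 := by rw [hk2]; simp [k0]
      have hs : Real.sqrt k * Real.sqrt k = 2 := by
        rw [Real.mul_self_sqrt (by positivity), hk2]; norm_num
      simp [omR, omg, e0]
      linear_combination (-(δ : ℝ)) * hs
  · show |d.1.2 / c.1.2| < ε * Real.sqrt (2 * k / (Nm k c ^ 2 * (k0 k) ^ 2) - B) + _
    rw [harg]
    by_contra hcon
    push Not at hcon
    have hdc : d.1.2 / c.1.2 = X2 - x2 p := by rw [hX2]; ring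
    rw [hdc] at hcon
    have h3 := abs_sub X2 (x2 p)
    have h4 : |x2 p| ≤ (1 - omg' k) / 2 := by
      rw [hx2]; exact (st_bd2 s t _ hω' hs ht).1
    have h5 : X1 = 0 := by
      by_contra h; have := b2.2.2 h; linarith
    have h6 : |x2 p| = (1 - omg' k) / 2 := by linarith [b2.2.1]
    have h7 : |X2| = ε * Real.sqrt (1 / (Nm k c ^ 2 * B) - B) := by linarith [b2.2.1]
    obtain ⟨δ, hδ1, hδ2, hδ3⟩ : ∃ δ : ℤ, s = δ / 2 ∧ t = - δ / 2 ∧ (δ = 1 ∨ δ = -1) := by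
      exact (st_bd2 s t _ hω' hs ht).2 (by rw [← hx2]; exact h6)
    have h8 : 2 * d = (-(δ : R k) * (1 - omR k)) * c := by
      apply R_ext1 k hk hk1
      have a1 : ((2 : R k) : ℝ × ℝ) = 2 := rfl
      simp [omR, a1]
      rw [hX1, hx1, hδ1, hδ2] at h5
      field_simp at h5
      linarith
    have h9 : X2 = 0 := by
      have := congrArg (fun z : R k => z.1.2) h8
      have a1 : ((2 : R k) : ℝ × ℝ) = 2 := rfl
      simp [omR, a1] at this
      rw [hX2, hx2, hδ1, hδ2]
      field_simp
      linarith
    refine nn _ h5 h9 (by positivity) ?_ h8 ?_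
    · rw [h9, abs_zero] at h7
      have := mul_eq_zero.1 h7.symm
      rcases this with h | h
      · linarith
      · exact Real.sqrt_eq_zero'.1 h
    · intro hk2
      exact ⟨(δ : R k), by ring⟩

/-- First embedding. -/
def emb1 (k : ℕ) : R k →+* ℝ := (RingHom.fst ℝ ℝ).comp (R k).subtype

/-- Second embedding. -/
def emb2 (k : ℕ) : R k →+* ℝ := (RingHom.snd ℝ ℝ).comp (R k).subtype

lemma unit_zpow1 (k : ℕ) (e : (R k)ˣ) (n : ℤ) :
    ((e ^ n : (R k)ˣ) : R k).1.1 = ((e : R k).1.1) ^ n := by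
  have h := map_zpow (Units.map (emb1 k).toMonoidHom) e n
  have h2 := congrArg (fun z : ℝˣ => (z : ℝ)) h
  rw [Units.val_zpow_eq_zpow_val] at h2
  exact h2

lemma unit_zpow2 (k : ℕ) (e : (R k)ˣ) (n : ℤ) :
    ((e ^ n : (R k)ˣ) : R k).1.2 = ((e : R k).1.2) ^ n := by
  have h := map_zpow (Units.map (emb2 k).toMonoidHom) e n
  have h2 := congrArg (fun z : ℝˣ => (z : ℝ)) h
  rw [Units.val_zpow_eq_zpow_val] at h2
  exact h2

lemma min_att (k : ℕ) (hk : Squarefree k) (hk1 : 1 < k) (e : (R k)ˣ) (he : 1 < (e : R k).1.1)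
    (X : Set (R k × R k)) (hX : X.Nonempty) (h0 : ∀ x ∈ X, x ≠ 0)
    (hu : ∀ x ∈ X, ∀ u : (R k)ˣ, ((u : R k) * x.1, (u : R k) * x.2) ∈ X)
    (p : Pt) (hp : p ∈ HH) :
    ∃ x ∈ X, ∀ y ∈ X, HNorm x.1.1 x.2.1 p ≤ HNorm y.1.1 y.2.1 p := by
  obtain ⟨x0, hx0⟩ := hX
  set m := HNorm x0.1.1 x0.2.1 p with hm
  set E := (e : R k).1.1 with hE
  set K := max (E ^ 2) m with hK
  set T : Set (R k × R k) := {cd | cd ∈ X ∧ qq cd.1.1.1 cd.2.1.1 (x1 p) (y1 p) ≤ K ∧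
      qq cd.1.1.2 cd.2.1.2 (x2 p) (y2 p) ≤ K} with hT
  have hTf : T.Finite := (pair_fin k hk1 p hp K).subset (fun x hx => hx.2)
  have key : ∀ y ∈ X, HNorm y.1.1 y.2.1 p ≤ m → ∃ z ∈ T,
      HNorm z.1.1 z.2.1 p = HNorm y.1.1 y.2.1 p := by
    intro y hy hym
    have hq1 : 0 < qq y.1.1.1 y.2.1.1 (x1 p) (y1 p) :=
      qq_pos _ _ _ _ hp.1 (pair_ne k hk hk1 y (h0 y hy)).1
    have hE2 : 1 < E ^ 2 := by nlinarith
    obtain ⟨n, hn1, hn2⟩ := exists_mem_Ico_zpow hq1 hE2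
    have hEp : 0 < (E ^ 2) ^ n := zpow_pos (by positivity) n
    have hinv : HNorm (((e ^ (-n) : (R k)ˣ) : R k) * y.1 : R k).1
        (((e ^ (-n) : (R k)ˣ) : R k) * y.2 : R k).1 p = HNorm y.1.1 y.2.1 p := by
      rw [HNorm_smul, Nm_unit k hk hk1, one_mul]
    have hq : qq (((e ^ (-n) : (R k)ˣ) : R k) * y.1 : R k).1.1
        (((e ^ (-n) : (R k)ˣ) : R k) * y.2 : R k).1.1 (x1 p) (y1 p)
        = ((E ^ 2) ^ n)⁻¹ * qq y.1.1.1 y.2.1.1 (x1 p) (y1 p) := by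
      have : ((e ^ (-n) : (R k)ˣ) : R k).1.1 ^ 2 = ((E ^ 2) ^ n)⁻¹ := by
        rw [unit_zpow1, ← hE, zpow_neg, inv_pow]
        congr 1
        rw [← zpow_natCast, ← zpow_natCast, zpow_comm]
      rw [← this, ← qq_smul]; rfl
    refine ⟨(_, _), ⟨hu y hy (e ^ (-n)), ?_, ?_⟩, hinv⟩
    · simp only; rw [hq]
      refine le_trans ?_ (le_max_left _ _)
      rw [inv_mul_le_iff₀ hEp, ← zpow_add_one₀ (by positivity)]
      exact hn2.le
    · simp only
      refine le_trans ?_ (le_max_right _ _)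
      refine le_trans ?_ hym
      rw [← hinv, HNorm_eq, hq]
      apply le_mul_of_one_le_left (qq_nonneg _ _ _ _)
      rw [le_inv_mul_iff₀ hEp, mul_one]; exact hn1
  obtain ⟨z0, hz0, hz0'⟩ := key x0 hx0 le_rfl
  obtain ⟨x, hx, hxm⟩ := Set.exists_min_image T (fun z => HNorm z.1.1 z.2.1 p) hTf ⟨z0, hz0⟩
  refine ⟨x, hx.1, fun y hy => ?_⟩
  rcases le_total (HNorm y.1.1 y.2.1 p) m with h | h
  · obtain ⟨z, hz, hz'⟩ := key y hy h
    rw [← hz']; exact hxm z hz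
  · have := hxm z0 hz0
    change _ ≤ HNorm z0.1.1 z0.2.1 p at this
    rw [hz0'] at this
    exact this.trans h

lemma qq_cmp (η x y u v : ℝ) (hη : 0 < η) (h : (1 + 1 / η) * (x - u) ^ 2 + y ^ 2 ≤ (1 + η) * v ^ 2)
    (c d : ℝ) : qq c d x y ≤ (1 + η) * qq c d u v := by
  unfold qq
  have h1 := mul_le_mul_of_nonneg_left h (sq_nonneg c)
  have h2 : (c * x + d) ^ 2 ≤ (1 + η) * (c * u + d) ^ 2 + (1 + 1 / η) * (c * (x - u)) ^ 2 := by
    have e : (1 + η) * (c * u + d) ^ 2 + (1 + 1 / η) * (c * (x - u)) ^ 2 - (c * x + d) ^ 2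
      = (1 / η) * (η * (c * u + d) - c * (x - u)) ^ 2 := by field_simp; ring
    have : 0 ≤ (1 / η) * (η * (c * u + d) - c * (x - u)) ^ 2 := by positivity
    linarith
  nlinarith

lemma HH_open : IsOpen HH := by
  have : HH = {p : Pt | 0 < p.2.2.1} ∩ {p : Pt | 0 < p.2.2.2} := rfl
  rw [this]
  exact (isOpen_lt (by fun_prop) (by fun_prop)).inter (isOpen_lt (by fun_prop) (by fun_prop))

lemma HH_preconn : IsPreconnected HH := by
  apply Convex.isPreconnected
  rintro p ⟨hp1, hp2⟩ q ⟨hq1, hq2⟩ a b ha hb hab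
  unfold y1 y2 at *
  have : ∀ s t : ℝ, 0 < s → 0 < t → 0 < a * s + b * t := by
    intro s t hs ht
    rcases ha.lt_or_eq with h | h
    · have := mul_pos h hs; have := mul_nonneg hb ht.le; linarith
    · subst h; simp at hab; subst hab; simpa using ht
  exact ⟨this _ _ hp1 hq1, this _ _ hp2 hq2⟩

open Topology Filter in
lemma equi (p : Pt) (hp : p ∈ HH) (η : ℝ) (hη : 0 < η) :
    ∀ᶠ w in 𝓝 p, ∀ c d : ℝ × ℝ, HNorm c d p ≤ (1 + η) ^ 2 * HNorm c d w := by
  obtain ⟨hp1, hp2⟩ := hp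
  have a1 : ∀ᶠ w : Pt in 𝓝 p, (1 + 1 / η) * (x1 p - x1 w) ^ 2 + y1 p ^ 2 < (1 + η) * y1 w ^ 2 := by
    apply ContinuousAt.eventually_lt
    · unfold x1; fun_prop
    · unfold y1; fun_prop
    · have : 0 < η * y1 p ^ 2 := by positivity
      simp; linarith
  have a2 : ∀ᶠ w : Pt in 𝓝 p, (1 + 1 / η) * (x2 p - x2 w) ^ 2 + y2 p ^ 2 < (1 + η) * y2 w ^ 2 := by
    apply ContinuousAt.eventually_lt
    · unfold x2; fun_prop
    · unfold y2; fun_prop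
    · have : 0 < η * y2 p ^ 2 := by positivity
      simp; linarith
  filter_upwards [a1, a2] with w h1 h2 c d
  rw [HNorm_eq, HNorm_eq]
  have b1 := qq_cmp η _ _ _ _ hη h1.le c.1 d.1
  have b2 := qq_cmp η _ _ _ _ hη h2.le c.2 d.2
  calc _ ≤ _ := mul_le_mul b1 b2 (qq_nonneg _ _ _ _) (mul_nonneg (by positivity) (qq_nonneg _ _ _ _))
    _ = _ := by ring

/-- Points where `A` strictly beats `B`. -/
def OO (k : ℕ) (A B : Set (R k × R k)) : Set Pt :=
  {p ∈ HH | ∃ x ∈ A, ∀ y ∈ B, HNorm x.1.1 x.2.1 p < HNorm y.1.1 y.2.1 p}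

open Topology Filter in
lemma OO_open (k : ℕ) (hk : Squarefree k) (hk1 : 1 < k) (e : (R k)ˣ) (he : 1 < (e : R k).1.1)
    (A X : Set (R k × R k)) (hX : X.Nonempty) (h0 : ∀ x ∈ X, x ≠ 0)
    (hu : ∀ x ∈ X, ∀ u : (R k)ˣ, ((u : R k) * x.1, (u : R k) * x.2) ∈ X) :
    IsOpen (OO k A X) := by
  rw [isOpen_iff_mem_nhds]
  rintro p ⟨hp, x, hx, hxy⟩
  obtain ⟨y, hy, hym⟩ := min_att k hk hk1 e he X hX h0 hu p hp
  have hlt := hxy y hy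
  set a := HNorm x.1.1 x.2.1 p with ha
  set b := HNorm y.1.1 y.2.1 p with hb
  have hb0 : 0 < b := HNorm_pos k hk hk1 y (h0 y hy) p hp
  have ha0 : 0 ≤ a := mul_nonneg (qq_nonneg _ _ _ _) (qq_nonneg _ _ _ _)
  obtain ⟨η, hη, hη2⟩ : ∃ η : ℝ, 0 < η ∧ (1 + η) ^ 2 * a < b := by
    have : ∀ᶠ η : ℝ in 𝓝[>] 0, (1 + η) ^ 2 * a < b := by
      apply Filter.Eventually.filter_mono nhdsWithin_le_nhds
      apply ContinuousAt.eventually_lt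
      · fun_prop
      · fun_prop
      · simpa using hlt
    obtain ⟨η, h1, h2⟩ := (this.and self_mem_nhdsWithin).exists
    exact ⟨η, h2, h1⟩
  have c1 := equi p hp η hη
  have c2 : ∀ᶠ w in 𝓝 p, (1 + η) ^ 2 * HNorm x.1.1 x.2.1 w < b := by
    apply ContinuousAt.eventually_lt
    · unfold HNorm x1 x2 y1 y2; fun_prop
    · fun_prop
    · exact hη2
  filter_upwards [c1, c2, HH_open.mem_nhds hp] with w h1 h2 h3
  refine ⟨h3, x, hx, fun z hz => ?_⟩
  have := (hym z hz).trans (h1 z.1.1 z.2.1)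
  have h4 := h2.trans_le this
  exact lt_of_mul_lt_mul_left h4 (by positivity)

lemma conn_arg (k : ℕ) (hk : Squarefree k) (hk1 : 1 < k) (e : (R k)ˣ) (he : 1 < (e : R k).1.1)
    (A X : Set (R k × R k)) (hX : X.Nonempty) (h0 : ∀ x ∈ X, x ≠ 0)
    (hu : ∀ x ∈ X, ∀ u : (R k)ˣ, ((u : R k) * x.1, (u : R k) * x.2) ∈ X)
    (hA : A.Nonempty) (h0A : ∀ x ∈ A, x ≠ 0)
    (huA : ∀ x ∈ A, ∀ u : (R k)ˣ, ((u : R k) * x.1, (u : R k) * x.2) ∈ A)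
    (p q : Pt) (hp : p ∈ HH) (hq : q ∈ HH)
    (hpA : ∃ x ∈ A, ∀ z ∈ A ∪ X, HNorm x.1.1 x.2.1 p ≤ HNorm z.1.1 z.2.1 p)
    (hqX : ∃ x ∈ X, ∀ z ∈ A ∪ X, HNorm x.1.1 x.2.1 q ≤ HNorm z.1.1 z.2.1 q) :
    ∃ w ∈ HH, ∃ x ∈ A, ∃ y ∈ X, HNorm x.1.1 x.2.1 w = HNorm y.1.1 y.2.1 w ∧
      ∀ z ∈ A ∪ X, HNorm x.1.1 x.2.1 w ≤ HNorm z.1.1 z.2.1 w := by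
  by_contra hcon
  obtain ⟨a0, ha0, ha1⟩ := hpA
  obtain ⟨b0, hb0, hb1⟩ := hqX
  have hpO : p ∈ OO k A X := by
    refine ⟨hp, a0, ha0, fun y hy => lt_of_le_of_ne (ha1 y (Or.inr hy)) fun h => ?_⟩
    exact hcon ⟨p, hp, a0, ha0, y, hy, h, ha1⟩
  have hqO : q ∈ OO k X A := by
    refine ⟨hq, b0, hb0, fun y hy => lt_of_le_of_ne (hb1 y (Or.inl hy)) fun h => ?_⟩
    exact hcon ⟨q, hq, y, hy, b0, hb0, h.symm, fun z hz => h ▸ hb1 z hz⟩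
  have o1 := OO_open k hk hk1 e he A X hX h0 hu
  have o2 := OO_open k hk hk1 e he X A hA h0A huA
  obtain ⟨w, hw, ⟨_, a, ha, ha'⟩, ⟨_, b, hb, hb'⟩⟩ := HH_preconn _ _ o1 o2 (by
    intro w hw
    obtain ⟨x, hx, hxm⟩ := min_att k hk hk1 e he X hX h0 hu w hw
    obtain ⟨a, ha, ham⟩ := min_att k hk hk1 e he A hA h0A huA w hw
    rcases lt_trichotomy (HNorm a.1.1 a.2.1 w) (HNorm x.1.1 x.2.1 w) with h | h | h
    · exact Or.inl ⟨hw, a, ha, fun y hy => h.trans_le (hxm y hy)⟩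
    · exfalso
      refine hcon ⟨w, hw, a, ha, x, hx, h, ?_⟩
      rintro z (hz | hz)
      · exact ham z hz
      · rw [h]; exact hxm z hz
    · exact Or.inr ⟨hw, x, hx, fun y hy => h.trans_le (ham y hy)⟩) ⟨p, hp, hpO⟩ ⟨q, hq, hqO⟩
  exact lt_asymm (ha' b hb) (hb' a ha)

lemma qq_moeb (c d α β γ δ x y : ℝ) (hdet : α * δ - β * γ = 1) (hq : qq γ δ x y ≠ 0) :
    qq c d (moeb α β γ δ x y).1 (moeb α β γ δ x y).2 * qq γ δ x y
      = qq (c * α + d * γ) (c * β + d * δ) x y := by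
  have e1 : (moeb α β γ δ x y).1 = ((α * x + β) * (γ * x + δ) + α * γ * y ^ 2) / qq γ δ x y := rfl
  have e2 : (moeb α β γ δ x y).2 = y / qq γ δ x y := rfl
  rw [e1, e2]
  have hA : ((α * x + β) * (γ * x + δ) + α * γ * y ^ 2) ^ 2 + y ^ 2
      = qq γ δ x y * ((α * x + β) ^ 2 + α ^ 2 * y ^ 2) := by
    unfold qq
    linear_combination (-y ^ 2) * (1 + (α * δ - β * γ)) * hdet
  set A := (α * x + β) * (γ * x + δ) + α * γ * y ^ 2 with hAdef
  have h1 : qq c d (A / qq γ δ x y) (y / qq γ δ x y) * qq γ δ x y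
      = c ^ 2 * ((A ^ 2 + y ^ 2) / qq γ δ x y) + 2 * c * d * A + d ^ 2 * qq γ δ x y := by
    generalize qq γ δ x y = Q at *
    unfold qq
    field_simp
    ring
  rw [h1, hA, mul_div_cancel_left₀ _ hq, hAdef]
  unfold qq
  ring

/-- Norm of the bottom row. -/
def rowN (k : ℕ) (h : SL k) (p : Pt) : ℝ := HNorm (h.1 1 0).1 (h.1 1 1).1 p

lemma det2 (k : ℕ) (g : SL k) : g.1 0 0 * g.1 1 1 - g.1 0 1 * g.1 1 0 = 1 := by
  rw [← Matrix.det_fin_two]; exact g.2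

lemma row_ne (k : ℕ) (hk1 : 1 < k) (g : SL k) : (g.1 1 0, g.1 1 1) ≠ (0 : R k × R k) := by
  intro h
  have h1 := congrArg Prod.fst h
  have h2 := congrArg Prod.snd h
  have h3 := det2 k g
  simp only [Prod.fst_zero, Prod.snd_zero] at h1 h2
  rw [h1, h2] at h3
  simp at h3

lemma rowN_pos (k : ℕ) (hk : Squarefree k) (hk1 : 1 < k) (g : SL k) (p : Pt) (hp : p ∈ HH) :
    0 < rowN k g p := HNorm_pos k hk hk1 _ (row_ne k hk1 g) p hp

lemma row_qq (k : ℕ) (hk : Squarefree k) (hk1 : 1 < k) (g : SL k) (p : Pt) (hp : p ∈ HH) :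
    0 < qq (g.1 1 0).1.1 (g.1 1 1).1.1 (x1 p) (y1 p) ∧
    0 < qq (g.1 1 0).1.2 (g.1 1 1).1.2 (x2 p) (y2 p) := by
  have := pair_ne k hk hk1 _ (row_ne k hk1 g)
  exact ⟨qq_pos _ _ _ _ hp.1 this.1, qq_pos _ _ _ _ hp.2 this.2⟩

lemma act_HH (k : ℕ) (hk : Squarefree k) (hk1 : 1 < k) (g : SL k) (p : Pt) (hp : p ∈ HH) :
    act k g p ∈ HH := by
  have := row_qq k hk hk1 g p hp
  exact ⟨div_pos hp.1 this.1, div_pos hp.2 this.2⟩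

lemma cocycle (k : ℕ) (hk : Squarefree k) (hk1 : 1 < k) (h g : SL k) (p : Pt) (hp : p ∈ HH) :
    rowN k h (act k g p) * rowN k g p = rowN k (h * g) p := by
  have hq := row_qq k hk hk1 g p hp
  have d0 := det2 k g
  have d1 := congrArg (fun z : R k => z.1.1) d0
  have d2 := congrArg (fun z : R k => z.1.2) d0
  have m1 := qq_moeb (h.1 1 0).1.1 (h.1 1 1).1.1 _ _ _ _ _ _ d1 hq.1.ne'
  have m2 := qq_moeb (h.1 1 0).1.2 (h.1 1 1).1.2 _ _ _ _ _ _ d2 hq.2.ne'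
  have r0 : (h * g).1 1 0 = h.1 1 0 * g.1 0 0 + h.1 1 1 * g.1 1 0 := by
    simp [Matrix.mul_apply, Fin.sum_univ_two]
  have r1 : (h * g).1 1 1 = h.1 1 0 * g.1 0 1 + h.1 1 1 * g.1 1 1 := by
    simp [Matrix.mul_apply, Fin.sum_univ_two]
  unfold rowN
  rw [r0, r1]
  simp only [HNorm_eq]
  calc _ = _ := mul_mul_mul_comm _ _ _ _
    _ = _ := congrArg₂ (· * ·) m1 m2

/-- Upper triangular matrix. -/
def UT (k : ℕ) (u : (R k)ˣ) (b : R k) : SL k :=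
  ⟨!![(u : R k), b; 0, ((u⁻¹ : (R k)ˣ) : R k)], by simp [Matrix.det_fin_two]⟩

/-- Build an element from its entries. -/
def mk2 (k : ℕ) (a b c d : R k) (h : a * d - b * c = 1) : SL k :=
  ⟨!![a, b; c, d], by rw [Matrix.det_fin_two]; exact h⟩

lemma moebUT (u v b x y : ℝ) (h : u * v = 1) :
    moeb u b 0 v x y = (u ^ 2 * x + b * u, u ^ 2 * y) := by
  have hu : u ≠ 0 := left_ne_zero_of_mul_eq_one h
  have hv : v = u⁻¹ := eq_inv_of_mul_eq_one_right h
  subst hv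
  unfold moeb
  ext
  · simp; field_simp
  · simp; field_simp

lemma move (k : ℕ) (hk : Squarefree k) (hk1 : 1 < k) (e : (R k)ˣ) (he : 1 < (e : R k).1.1)
    (W : Pt) (hW : W ∈ HH) : ∃ g : SL k, g.1 1 0 = 0 ∧ ∃ s t : ℝ, |s| ≤ 1 / 2 ∧ |t| ≤ 1 / 2 ∧
      x1 (act k g W) = s + t * omg k ∧ x2 (act k g W) = s + t * omg' k ∧
      y1 (act k g W) ≤ (e : R k).1.1 ^ 2 * y2 (act k g W) ∧
      y2 (act k g W) ≤ (e : R k).1.1 ^ 2 * y1 (act k g W) := by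
  set E := (e : R k).1.1 with hE
  obtain ⟨hy1, hy2⟩ := hW
  have hE0 : 0 < E := by linarith
  have hE4 : 1 < E ^ 4 := one_lt_pow₀ he (by norm_num)
  obtain ⟨m, hm1, hm2⟩ := exists_mem_Ico_zpow
    (x := y1 W / y2 W * E ^ 2) (by positivity) hE4
  set u := e ^ (-m) with hu
  set a := (u : R k).1.1 with ha
  set a' := (u : R k).1.2 with ha'
  have ha4 : a ^ 4 = ((E ^ 4) ^ m)⁻¹ := by
    rw [ha, hu, unit_zpow1, ← hE, zpow_neg, inv_pow]
    congr 1
    rw [← zpow_natCast, ← zpow_natCast, zpow_comm]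
  have haa : a ^ 2 * a' ^ 2 = 1 := by
    have := Nm_unit k hk hk1 u
    rw [← mul_pow]; exact this
  have hd := om_sub_pos k hk1
  set X1 := a ^ 2 * x1 W with hX1
  set X2 := a' ^ 2 * x2 W with hX2
  set t0 := (X1 - X2) / (omg k - omg' k) with ht0
  set s0 := X1 - t0 * omg k with hs0
  have hX1' : X1 = s0 + t0 * omg k := by rw [hs0]; ring
  have hX2' : X2 = s0 + t0 * omg' k := by
    have : t0 * (omg k - omg' k) = X1 - X2 := by rw [ht0]; field_simp
    rw [hs0]; linarith
  set b : R k := -((round s0 : ℤ) : R k) - ((round t0 : ℤ) : R k) * omR k with hb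
  have hb1 : b.1.1 = -(round s0 : ℝ) - (round t0 : ℝ) * omg k := by simp [hb, omR]
  have hb2 : b.1.2 = -(round s0 : ℝ) - (round t0 : ℝ) * omg' k := by simp [hb, omR]
  have i1 : (u : R k).1.1 * ((u⁻¹ : (R k)ˣ) : R k).1.1 = 1 :=
    congrArg (fun z : R k => z.1.1) u.mul_inv
  have i2 : (u : R k).1.2 * ((u⁻¹ : (R k)ˣ) : R k).1.2 = 1 :=
    congrArg (fun z : R k => z.1.2) u.mul_inv
  set c : R k := b * ((u⁻¹ : (R k)ˣ) : R k) with hc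
  have M1 := moebUT _ _ c.1.1 (x1 W) (y1 W) i1
  have M2 := moebUT _ _ c.1.2 (x2 W) (y2 W) i2
  have hc1 : c.1.1 * (u : R k).1.1 = b.1.1 := by
    have : c.1.1 = b.1.1 * ((u⁻¹ : (R k)ˣ) : R k).1.1 := rfl
    rw [this, mul_assoc, mul_comm _ (u : R k).1.1, i1, mul_one]
  have hc2 : c.1.2 * (u : R k).1.2 = b.1.2 := by
    have : c.1.2 = b.1.2 * ((u⁻¹ : (R k)ˣ) : R k).1.2 := rfl
    rw [this, mul_assoc, mul_comm _ (u : R k).1.2, i2, mul_one]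
  have A1 : x1 (act k (UT k u c) W) = a ^ 2 * x1 W + b.1.1 := by
    rw [← hc1]; exact congrArg Prod.fst M1
  have A2 : x2 (act k (UT k u c) W) = a' ^ 2 * x2 W + b.1.2 := by
    rw [← hc2]; exact congrArg Prod.fst M2
  have A3 : y1 (act k (UT k u c) W) = a ^ 2 * y1 W := congrArg Prod.snd M1
  have A4 : y2 (act k (UT k u c) W) = a' ^ 2 * y2 W := congrArg Prod.snd M2
  have hEm : 0 < (E ^ 4) ^ m := zpow_pos (by positivity) m
  have hap : 0 < a ^ 2 := by
    rcases (sq_nonneg a).lt_or_eq with h | h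
    · exact h
    · rw [← h] at haa; simp at haa
  have hau : a ^ 4 * (E ^ 4) ^ m = 1 := by rw [ha4]; field_simp
  refine ⟨UT k u c, rfl, s0 - round s0, t0 - round t0, abs_sub_round _, abs_sub_round _, ?_, ?_, ?_, ?_⟩
  · rw [A1, hb1, ← hX1, hX1']; ring
  · rw [A2, hb2, ← hX2, hX2']; ring
  · rw [A3, A4]
    rw [zpow_add_one₀ (by positivity)] at hm2
    have h1 : a ^ 4 * (y1 W * E ^ 2) < y2 W * E ^ 4 := by
      have h2 : y1 W * E ^ 2 < (E ^ 4) ^ m * E ^ 4 * y2 W := by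
        have : y1 W / y2 W * E ^ 2 = (y1 W * E ^ 2) / y2 W := by ring
        rw [this, div_lt_iff₀ hy2] at hm2; exact hm2
      have h3 := mul_lt_mul_of_pos_left h2 (show 0 < a ^ 4 by rw [ha4]; positivity)
      calc _ < _ := h3
        _ = (a ^ 4 * (E ^ 4) ^ m) * (y2 W * E ^ 4) := by ring
        _ = _ := by rw [hau, one_mul]
    have h4 : a ^ 2 * E ^ 2 * (a ^ 2 * y1 W) ≤ a ^ 2 * E ^ 2 * (E ^ 2 * (a' ^ 2 * y2 W)) := by
      calc _ = a ^ 4 * (y1 W * E ^ 2) := by ring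
        _ ≤ y2 W * E ^ 4 := h1.le
        _ = (a ^ 2 * a' ^ 2) * (y2 W * E ^ 4) := by rw [haa, one_mul]
        _ = _ := by ring
    exact le_of_mul_le_mul_left h4 (by positivity)
  · rw [A3, A4]
    have h1 : y2 W ≤ a ^ 4 * (y1 W * E ^ 2) := by
      have h2 : (E ^ 4) ^ m * y2 W ≤ y1 W * E ^ 2 := by
        have : y1 W / y2 W * E ^ 2 = (y1 W * E ^ 2) / y2 W := by ring
        rw [this, le_div_iff₀ hy2] at hm1; exact hm1
      have h3 := mul_le_mul_of_nonneg_left h2 (show 0 ≤ a ^ 4 by rw [ha4]; positivity)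
      calc _ = (a ^ 4 * (E ^ 4) ^ m) * y2 W := by rw [hau, one_mul]
        _ ≤ _ := by rw [mul_assoc]; exact h3
    have h4 : a ^ 2 * (a' ^ 2 * y2 W) ≤ a ^ 2 * (E ^ 2 * (a ^ 2 * y1 W)) := by
      calc _ = (a ^ 2 * a' ^ 2) * y2 W := by ring
        _ = y2 W := by rw [haa, one_mul]
        _ ≤ _ := h1
        _ = _ := by ring
    exact le_of_mul_le_mul_left h4 hap

lemma base_pt (k : ℕ) (hk : Squarefree k) (hk1 : 1 < k) (h : SL k) :
    1 ≤ rowN k h ((0, 0, 1, 1) : Pt) := by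
  have h1 : rowN k h ((0, 0, 1, 1) : Pt) = Nm k (h.1 1 0) ^ 2 + Nm k (h.1 1 1) ^ 2
      + ((h.1 1 0).1.1 * (h.1 1 1).1.2) ^ 2 + ((h.1 1 1).1.1 * (h.1 1 0).1.2) ^ 2 := by
    simp only [rowN, HNorm, Nm, x1, x2, y1, y2]; ring
  rw [h1]
  by_cases hc : h.1 1 0 = 0
  · have hd : h.1 1 1 ≠ 0 := fun hd => row_ne k hk1 h (by rw [hc, hd]; rfl)
    have := Nm_sq k hk hk1 _ hd
    linarith [sq_nonneg (Nm k (h.1 1 0)), sq_nonneg ((h.1 1 0).1.1 * (h.1 1 1).1.2), sq_nonneg ((h.1 1 1).1.1 * (h.1 1 0).1.2)]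
  · have := Nm_sq k hk hk1 _ hc
    linarith [sq_nonneg (Nm k (h.1 1 1)), sq_nonneg ((h.1 1 0).1.1 * (h.1 1 1).1.2), sq_nonneg ((h.1 1 1).1.1 * (h.1 1 0).1.2)]

lemma base_one (k : ℕ) : rowN k 1 ((0, 0, 1, 1) : Pt) = 1 := by
  simp [rowN, HNorm, x1, x2, y1, y2]

lemma main_gen (k : ℕ) (hk : Squarefree k) (hk1 : 1 < k) (hPID : IsPrincipalIdealRing (R k))
    (e : (R k)ˣ) (he : 1 < (e : R k).1.1) (G : Subgroup (SL k))
    (hup : ∀ g : SL k, g.1 1 0 = 0 → g ∈ G)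
    (hrow : ∀ cd : R k × R k, SCond k ((e : R k).1.1) cd →
      ∃ g ∈ G, g.1 1 0 = cd.1 ∧ g.1 1 1 = cd.2) (γ : SL k) : γ ∈ G := by
  by_contra hγ
  have hsc : ∀ (u : (R k)ˣ) (g : SL k), (UT k u⁻¹ 0 * g).1 1 0 = (u : R k) * g.1 1 0 ∧
      (UT k u⁻¹ 0 * g).1 1 1 = (u : R k) * g.1 1 1 := by
    intro u g
    rw [Matrix.SpecialLinearGroup.coe_mul]
    simp [UT, Matrix.mul_apply, Fin.sum_univ_two]
  have hUT : ∀ u : (R k)ˣ, UT k u⁻¹ 0 ∈ G := fun u => hup _ rfl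
  set A : Set (R k × R k) := {x | ∃ g ∈ G, (g.1 1 0, g.1 1 1) = x} with hA
  set X : Set (R k × R k) := {x | ∃ g, g ∉ G ∧ (g.1 1 0, g.1 1 1) = x} with hX
  have hmem : ∀ h : SL k, (h.1 1 0, h.1 1 1) ∈ A ∪ X := by
    intro h
    by_cases hh : h ∈ G
    · exact Or.inl ⟨h, hh, rfl⟩
    · exact Or.inr ⟨h, hh, rfl⟩
  have p0 : ((0, 0, 1, 1) : Pt) ∈ HH := ⟨one_pos, one_pos⟩
  obtain ⟨Z, hZ, x, ⟨g1, hg1, rfl⟩, y, ⟨g2, hg2, rfl⟩, heq, hmin⟩ := conn_arg k hk hk1 e he A X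
    ⟨_, γ, hγ, rfl⟩ (by rintro x ⟨g, _, rfl⟩; exact row_ne k hk1 g)
    (by
      rintro x ⟨g, hg, rfl⟩ u
      refine ⟨UT k u⁻¹ 0 * g, fun h => hg ((Subgroup.mul_mem_cancel_left G (hUT u)).1 h), ?_⟩
      rw [(hsc u g).1, (hsc u g).2])
    ⟨_, 1, G.one_mem, rfl⟩ (by rintro x ⟨g, _, rfl⟩; exact row_ne k hk1 g)
    (by
      rintro x ⟨g, hg, rfl⟩ u
      refine ⟨UT k u⁻¹ 0 * g, G.mul_mem (hUT u) hg, ?_⟩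
      rw [(hsc u g).1, (hsc u g).2])
    (0, 0, 1, 1) (act k γ⁻¹ (0, 0, 1, 1)) p0 (act_HH k hk hk1 _ _ p0)
    ⟨_, ⟨1, G.one_mem, rfl⟩, by
      have h1 : ∀ h : SL k, rowN k 1 (0, 0, 1, 1) ≤ rowN k h (0, 0, 1, 1) := by
        intro h; rw [base_one]; exact base_pt k hk hk1 h
      rintro z (⟨h, _, rfl⟩ | ⟨h, _, rfl⟩)
      · exact h1 h
      · exact h1 h⟩
    ⟨_, ⟨γ, hγ, rfl⟩, by
      have h1 : ∀ h : SL k, rowN k γ (act k γ⁻¹ (0, 0, 1, 1)) ≤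
          rowN k h (act k γ⁻¹ (0, 0, 1, 1)) := by
        intro h
        have c1 := cocycle k hk hk1 γ γ⁻¹ _ p0
        have c2 := cocycle k hk hk1 h γ⁻¹ _ p0
        rw [mul_inv_cancel, base_one] at c1
        have c3 := base_pt k hk hk1 (h * γ⁻¹)
        rw [← c2] at c3
        exact le_of_mul_le_mul_right (c1.le.trans c3) (rowN_pos k hk hk1 _ _ p0)
      rintro z (⟨h, _, rfl⟩ | ⟨h, _, rfl⟩)
      · exact h1 h
      · exact h1 h⟩
  have hmin' : ∀ h : SL k, rowN k g1 Z ≤ rowN k h Z := fun h => hmin _ (hmem h)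
  have heq' : rowN k g1 Z = rowN k g2 Z := heq
  obtain ⟨δ, hδ, s, t, hs, ht, hx1, hx2, hr1, hr2⟩ := move k hk hk1 e he (act k g1 Z)
    (act_HH k hk hk1 _ _ hZ)
  have hδG := hup δ hδ
  have hW := act_HH k hk hk1 g1 Z hZ
  have hW2 := act_HH k hk hk1 δ _ hW
  set W := act k g1 Z with hWdef
  set W2 := act k δ W with hW2def
  have hδ1 : rowN k δ W = 1 := by
    have h1 := det2 k δ
    rw [hδ, mul_zero, sub_zero] at h1
    have h2 := Nm_unit k hk hk1 ⟨δ.1 1 1, δ.1 0 0, by rw [mul_comm]; exact h1, h1⟩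
    rw [← h2]
    unfold rowN
    rw [hδ]
    simp [HNorm, Nm]; ring
  have hval : ∀ h : SL k, rowN k h W2 * rowN k g1 Z = rowN k (h * δ * g1) Z := by
    intro h
    rw [← cocycle k hk hk1 (h * δ) g1 Z hZ, ← cocycle k hk hk1 h δ _ hW, hδ1, mul_one]
  have hpos := rowN_pos k hk hk1 g1 Z hZ
  have hge : ∀ h : SL k, 1 ≤ rowN k h W2 := by
    intro h
    have := hmin' (h * δ * g1)
    rw [← hval] at this
    exact le_of_mul_le_mul_right (by linarith) hpos
  have H : ∀ cd : R k × R k, cd ≠ 0 → 1 ≤ HNorm cd.1.1 cd.2.1 W2 := by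
    rintro ⟨c, d⟩ hcd
    obtain ⟨g, c1, d1, a1, b1, hg, rfl, rfl, hab⟩ := bezout k hk hk1 hPID c d (by
      rintro ⟨rfl, rfl⟩; exact hcd rfl)
    simp only
    rw [HNorm_smul]
    have h1 := hge (mk2 k a1 b1 c1 d1 hab)
    have h2 : rowN k (mk2 k a1 b1 c1 d1 hab) W2 = HNorm c1.1 d1.1 W2 := rfl
    rw [h2] at h1
    have h3 := Nm_sq k hk hk1 g hg
    nlinarith
  set h := g2 * g1⁻¹ * δ⁻¹ with hh
  have hh1 : rowN k h W2 = 1 := by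
    have := hval h
    have e1 : h * δ * g1 = g2 := by rw [hh]; group
    rw [e1, ← heq'] at this
    exact mul_right_cancel₀ hpos.ne' (by rw [this, one_mul])
  apply hg2
  have hfin : h ∈ G := by
    by_cases hc : h.1 1 0 = 0
    · exact hup h hc
    · have hcop : Ideal.span {h.1 1 0, h.1 1 1} = ⊤ := by
        rw [Ideal.eq_top_iff_one, Ideal.mem_span_pair]
        exact ⟨-h.1 0 1, h.1 0 0, by linear_combination det2 k h⟩
      have hS := scond k hk hk1 hPID _ he W2 hW2 H s t hs ht hx1 hx2 hr1 hr2 _ _ hc hcop hh1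
      obtain ⟨g, hg, hg0, hg1'⟩ := hrow _ hS
      simp only at hg0 hg1'
      have : h * g⁻¹ ∈ G := by
        apply hup
        have : (h * g⁻¹).1 = h.1 * g.1.adjugate := by
          rw [Matrix.SpecialLinearGroup.coe_mul, Matrix.SpecialLinearGroup.coe_inv]
        rw [this, Matrix.adjugate_fin_two]
        simp [Matrix.mul_apply, Fin.sum_univ_two, hg0, hg1']
        ring
      exact (Subgroup.mul_mem_cancel_right G (G.inv_mem hg)).1 this
  have e2 : g2 = h * δ * g1 := by rw [hh]; group
  rw [e2]
  exact G.mul_mem (G.mul_mem hfin hδG) hg1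

/-- The subgroup of elements which agree up to sign with an element of `H`. -/
def pmG (k : ℕ) (H : Subgroup (SL k)) : Subgroup (SL k) where
  carrier := {g | ∃ h ∈ H, g.1 = h.1 ∨ g.1 = -h.1}
  one_mem' := ⟨1, H.one_mem, Or.inl rfl⟩
  mul_mem' := by
    rintro a b ⟨h, hh, h1⟩ ⟨g, hg, h2⟩
    refine ⟨h * g, H.mul_mem hh hg, ?_⟩
    rw [Matrix.SpecialLinearGroup.coe_mul, Matrix.SpecialLinearGroup.coe_mul]
    rcases h1 with h1 | h1 <;> rcases h2 with h2 | h2 <;> rw [h1, h2] <;> simp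
  inv_mem' := by
    rintro a ⟨h, hh, h1⟩
    refine ⟨h⁻¹, H.inv_mem hh, ?_⟩
    rw [Matrix.SpecialLinearGroup.coe_inv, Matrix.SpecialLinearGroup.coe_inv]
    rcases h1 with h1 | h1
    · left; rw [h1]
    · right; rw [h1, Matrix.adjugate_fin_two, Matrix.adjugate_fin_two]
      refine Matrix.ext fun i j => ?_; fin_cases i <;> fin_cases j <;> simp

/-- Translations. -/
def TT (k : ℕ) : Multiplicative (R k) →* SL k where
  toFun b := UT k 1 b.toAdd
  map_one' := by
    apply Subtype.ext; refine Matrix.ext fun i j => ?_; fin_cases i <;> fin_cases j <;> simp [UT]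
  map_mul' a b := by
    apply Subtype.ext; rw [Matrix.SpecialLinearGroup.coe_mul]
    refine Matrix.ext fun i j => ?_; fin_cases i <;> fin_cases j <;> simp [UT, Matrix.mul_apply, Fin.sum_univ_two, add_comm]

/-- Diagonal matrices. -/
def DD (k : ℕ) : (R k)ˣ →* SL k where
  toFun u := UT k u 0
  map_one' := by
    apply Subtype.ext; refine Matrix.ext fun i j => ?_; fin_cases i <;> fin_cases j <;> simp [UT]
  map_mul' a b := by
    apply Subtype.ext; rw [Matrix.SpecialLinearGroup.coe_mul]
    refine Matrix.ext fun i j => ?_; fin_cases i <;> fin_cases j <;> simp [UT, Matrix.mul_apply, Fin.sum_univ_two, mul_comm]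

lemma unit_form (k : ℕ) (hk : Squarefree k) (hk1 : 1 < k) (e : (R k)ˣ) (he : IsFundUnit k e)
    (u : (R k)ˣ) : ∃ n : ℤ, u = e ^ n ∨ u = -e ^ n := by
  obtain ⟨he1, hmin⟩ := he
  set E := (e : R k).1.1 with hE
  have he1' : 1 < E := he1
  have hu := (R_ne k hk hk1 _ (unit_ne k u)).1
  obtain ⟨n, hn1, hn2⟩ := exists_mem_Ico_zpow (abs_pos.2 hu) he1'
  refine ⟨n, ?_⟩
  have key : ∀ w : (R k)ˣ, E ^ n ≤ (w : R k).1.1 → (w : R k).1.1 < E ^ (n + 1) → w = e ^ n := by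
    intro w h1 h2
    have hEn : 0 < E ^ n := zpow_pos (by linarith) n
    have hv : ((w * e ^ (-n) : (R k)ˣ) : R k).1.1 = (w : R k).1.1 * (E ^ n)⁻¹ := by
      have : ((w * e ^ (-n) : (R k)ˣ) : R k).1.1 =
        (w : R k).1.1 * ((e ^ (-n) : (R k)ˣ) : R k).1.1 := rfl
      rw [this, unit_zpow1, zpow_neg]
    have h3 : 1 ≤ (w : R k).1.1 * (E ^ n)⁻¹ := by
      rw [← div_eq_mul_inv, le_div_iff₀ hEn, one_mul]; exact h1
    have h4 : (w : R k).1.1 * (E ^ n)⁻¹ < E := by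
      rw [← div_eq_mul_inv, div_lt_iff₀ hEn, mul_comm, ← zpow_add_one₀ (by linarith)]; exact h2
    rcases h3.lt_or_eq with h | h
    · exfalso
      have h5 := hmin (w * e ^ (-n)) (by unfold unitVal; rw [hv]; exact h)
      unfold unitVal at h5
      rw [hv] at h5
      exact absurd h5 (not_le.2 h4)
    · have h6 : (w : R k).1.1 = E ^ n := by
        rw [← div_eq_mul_inv, eq_div_iff hEn.ne', one_mul] at h
        exact h.symm
      apply Units.ext
      apply R_ext1 k hk hk1
      rw [h6, unit_zpow1]
  rcases abs_choice (u : R k).1.1 with h | h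
  · rw [h] at hn1 hn2
    exact Or.inl (key u hn1 hn2)
  · rw [h] at hn1 hn2
    right
    rw [← key (-u) hn1 hn2, neg_neg]

/-- Suppose `R` is a principal ideal domain and `S₁` is a set of
representatives, up to units, of the pairs `(c,d)` satisfying the conditions `SCond`. For
each `(c,d) ∈ S₁` choose `P_{c,d} ∈ Γ` with bottom row `(c, d)`, and let
`P₁ = (1 1; 0 1)`, `P₂ = (1 ω; 0 1)`, `P₃ = (ε₀ 0; 0 ε₀⁻¹)`. Then `Γ = PSL₂(R)` is
generated by `P₁, P₂, P₃` and the `P_{c,d}`, `(c,d) ∈ S₁`; at the level of `SL₂(R)`: every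
`g` agrees up to sign with an element of the subgroup generated by these matrices. -/
theorem generators_of_PSL (k : ℕ) (hk : Squarefree k) (hk1 : 1 < k)
    (e : (R k)ˣ) (he : IsFundUnit k e) (hPID : IsPrincipalIdealRing (R k))
    (S1 : Set (R k × R k)) (hS1 : IsRepSet k (eps k e) S1)
    (Q1 Q2 Q3 : SL k)
    (hQ1 : Q1.1 = !![1, 1; 0, 1])
    (hQ2 : Q2.1 = !![1, omR k; 0, 1])
    (hQ3 : Q3.1 = !![(e : R k), 0; 0, ((e⁻¹ : (R k)ˣ) : R k)])
    (P : R k × R k → SL k)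
    (hP : ∀ cd ∈ S1, (P cd).1 1 0 = cd.1 ∧ (P cd).1 1 1 = cd.2) :
    ∀ g : SL k, ∃ h ∈ Subgroup.closure ({Q1, Q2, Q3} ∪ P '' S1),
      g.1 = h.1 ∨ g.1 = -h.1 := by
  have heE : 1 < (e : R k).1.1 := he.1
  set H := Subgroup.closure ({Q1, Q2, Q3} ∪ P '' S1) with hH
  have hq1 : Q1 ∈ H := Subgroup.subset_closure (Or.inl (by simp))
  have hq2 : Q2 ∈ H := Subgroup.subset_closure (Or.inl (by simp))
  have hq3 : Q3 ∈ H := Subgroup.subset_closure (Or.inl (by simp))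
  have hp : ∀ cd ∈ S1, P cd ∈ H := fun cd h =>
    Subgroup.subset_closure (Or.inr ⟨cd, h, rfl⟩)
  have t1 : TT k (Multiplicative.ofAdd 1) = Q1 := by
    apply Subtype.ext; rw [hQ1]; change (UT k 1 1).1 = _; simp [UT]
  have t2 : TT k (Multiplicative.ofAdd (omR k)) = Q2 := by
    apply Subtype.ext; rw [hQ2]; change (UT k 1 (omR k)).1 = _; simp [UT]
  have t3 : DD k e = Q3 := by
    apply Subtype.ext; rw [hQ3]; change (UT k e 0).1 = _; simp [UT]
  have hT : ∀ b : R k, UT k 1 b ∈ H := by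
    intro b
    obtain ⟨m, n, h1, h2⟩ := R_rep k b
    have hb : b = m • (1 : R k) + n • omR k := by
      have := R_mk' k m n b h1 h2
      rw [this]; simp
    have : UT k 1 b = Q1 ^ m * Q2 ^ n := by
      rw [← t1, ← t2, ← map_zpow (TT k), ← map_zpow (TT k), ← map_mul (TT k), ← ofAdd_zsmul, ← ofAdd_zsmul,
        ← ofAdd_add, ← hb]; rfl
    rw [this]
    exact H.mul_mem (H.zpow_mem hq1 m) (H.zpow_mem hq2 n)
  have hD : ∀ n : ℤ, UT k (e ^ n) 0 ∈ H := by
    intro n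
    have : UT k (e ^ n) 0 = Q3 ^ n := by rw [← t3, ← map_zpow]; rfl
    rw [this]; exact H.zpow_mem hq3 n
  have hup : ∀ g : SL k, g.1 1 0 = 0 → g ∈ pmG k H := by
    intro g hg
    have hdet := det2 k g
    rw [hg, mul_zero, sub_zero] at hdet
    set u : (R k)ˣ := ⟨g.1 0 0, g.1 1 1, hdet, by rw [mul_comm]; exact hdet⟩ with hu
    have hu0 : g.1 0 0 = (u : R k) := rfl
    have hu1 : g.1 1 1 = ((u⁻¹ : (R k)ˣ) : R k) := rfl
    obtain ⟨n, hn⟩ := unit_form k hk hk1 e he u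
    refine ⟨UT k 1 (g.1 0 1 * u) * UT k (e ^ n) 0, H.mul_mem (hT _) (hD n), ?_⟩
    rw [Matrix.SpecialLinearGroup.coe_mul]
    rcases hn with hn | hn
    · left
      rw [← hn]
      refine Matrix.ext fun i j => ?_
      fin_cases i <;> fin_cases j <;>
        simp [UT, Matrix.mul_apply, Fin.sum_univ_two, hg, hu0, hu1]
    · right
      have hn' : e ^ n = -u := by rw [hn, neg_neg]
      rw [hn']
      refine Matrix.ext fun i j => ?_
      fin_cases i <;> fin_cases j <;>
        simp [UT, Matrix.mul_apply, Fin.sum_univ_two, hg, hu0, hu1]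
  have hrow : ∀ cd : R k × R k, SCond k ((e : R k).1.1) cd →
      ∃ g ∈ pmG k H, g.1 1 0 = cd.1 ∧ g.1 1 1 = cd.2 := by
    intro cd hcd
    obtain ⟨ab, hab, u, h1, h2⟩ := hS1.2.1 cd hcd
    refine ⟨UT k u⁻¹ 0 * P ab, (pmG k H).mul_mem (hup _ rfl) ⟨P ab, hp ab hab, Or.inl rfl⟩, ?_⟩
    rw [h1, h2, ← (hP ab hab).1, ← (hP ab hab).2, Matrix.SpecialLinearGroup.coe_mul]
    simp [UT, Matrix.mul_apply, Fin.sum_univ_two]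
  exact fun g => main_gen k hk hk1 hPID e heE (pmG k H) hup hrow g

end Hilbert
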